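/- arXiv:1809.00192 — 6 statements merged into one kernel-verified Lean document; each statement's English description precedes it below -/
import Mathlib

section
/- For every τ in the upper half-plane H, ℘̃a(1/2, τ/(4τ+1))² = (4τ+1)⁴ · ℘̃a(1/2, τ)²; consequently the function τ ↦ (1/256)·℘̃a(1/2,τ)² (the strong modular unit Δ₂) is a modular form of weight 4 for Γ₀(2). -/
open Complex

/-- The normalized Weierstrass function
`℘a(z,τ) = π⁻² (1/z² + Σ_{ω ∈ Λ_τ, ω ≠ 0} (1/(z-ω)² − 1/ω²))`, where `Λ_τ = ℤ + τℤ`. -/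
noncomputable def wpa (z τ : ℂ) : ℂ :=
  (Real.pi : ℂ)⁻¹ ^ 2 * (1 / z ^ 2 +
    ∑' p : ℤ × ℤ, if p = 0 then 0 else
      (1 / (z - ((p.1 : ℂ) + (p.2 : ℂ) * τ)) ^ 2 - 1 / ((p.1 : ℂ) + (p.2 : ℂ) * τ) ^ 2))

/-- The renormalized function
`℘̃a(z,τ) = π⁻² Σ_{(n,m)∈ℤ²} (1/(z+(n+1/2)+(m+1/2)τ)² − 1/((n+1/2)+(m+1/2)τ)²)`. -/
noncomputable def wpt (z τ : ℂ) : ℂ :=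
  (Real.pi : ℂ)⁻¹ ^ 2 *
    ∑' p : ℤ × ℤ,
      (1 / (z + ((p.1 : ℂ) + 1 / 2) + ((p.2 : ℂ) + 1 / 2) * τ) ^ 2 -
        1 / (((p.1 : ℂ) + 1 / 2) + ((p.2 : ℂ) + 1 / 2) * τ) ^ 2)

open PeriodPair Filter Topology

namespace Delta2

variable (L : PeriodPair)

lemma wp_half_deriv {a : ℂ} (h2a : 2 * a ∈ L.lattice) : L.derivWeierstrassP a = 0 := by
  have h := L.derivWeierstrassP_add_coe (-a) ⟨2 * a, h2a⟩
  rw [L.derivWeierstrassP_neg] at h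
  have : -a + 2 * a = a := by ring
  simp only [this] at h
  exact CharZero.eq_neg_self_iff.mp h

lemma wp_deriv2 {a : ℂ} (ha : a ∉ L.lattice) :
    deriv L.derivWeierstrassP a = 6 * L.sumInvPow a 4 := by
  have := L.deriv_derivWeierstrassPExcept_self a
  rwa [L.derivWeierstrassPExcept_of_notMem a ha] at this

/-- local factorization -/
lemma wp_factor {a : ℂ} (ha : a ∉ L.lattice) (h2a : 2 * a ∈ L.lattice) :
    ∃ h : ℂ → ℂ, AnalyticAt ℂ h 0 ∧ h 0 = 3 * L.sumInvPow a 4 ∧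
      ∀ᶠ z in 𝓝 (0 : ℂ), L.weierstrassP (z + a) - L.weierstrassP a = z ^ 2 * h z := by
  have hP : AnalyticAt ℂ L.weierstrassP a := L.analyticOnNhd_weierstrassP a ha
  have hP' : AnalyticAt ℂ L.derivWeierstrassP a := L.analyticOnNhd_derivWeierstrassP a ha
  have hPc : AnalyticAt ℂ (fun z => L.weierstrassP (z + a)) 0 := by
    have : AnalyticAt ℂ L.weierstrassP ((fun z => z + a) 0) := by simpa using hP
    exact this.comp (f := fun z : ℂ => z + a) (by fun_prop)
  have hg : AnalyticAt ℂ (fun z => L.weierstrassP (z + a) - L.weierstrassP a) 0 := by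
    fun_prop
  have hd1 : deriv (fun z => L.weierstrassP (z + a) - L.weierstrassP a)
      = fun z => L.derivWeierstrassP (z + a) := by
    ext z
    rw [deriv_sub_const, deriv_comp_add_const, L.deriv_weierstrassP]
  have hord : ((2 : ℕ) : ℕ∞) ≤
      analyticOrderAt (fun z => L.weierstrassP (z + a) - L.weierstrassP a) 0 := by
    rw [natCast_le_analyticOrderAt_iff_iteratedDeriv_eq_zero hg]
    intro i hi
    interval_cases i
    · simp
    · rw [iteratedDeriv_one, hd1]
      simpa using wp_half_deriv L h2a
  obtain ⟨h, hh, hev⟩ := (natCast_le_analyticOrderAt hg).mp hord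
  refine ⟨h, hh, ?_, ?_⟩
  · have e1 : (fun z => L.weierstrassP (z + a) - L.weierstrassP a) =ᶠ[𝓝 0]
        fun z => z ^ 2 * h z := by
      filter_upwards [hev] with z hz
      simpa using hz
    have e2 : (fun z => L.derivWeierstrassP (z + a)) =ᶠ[𝓝 0]
        fun z => 2 * z * h z + z ^ 2 * deriv h z := by
      rw [← hd1]
      refine e1.deriv.trans ?_
      filter_upwards [hh.eventually_analyticAt] with z hz
      have := ((hasDerivAt_pow 2 z).mul hz.differentiableAt.hasDerivAt).deriv
      simp at this
      exact this
    have e3 := e2.deriv_eq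
    rw [deriv_comp_add_const, zero_add, wp_deriv2 L ha] at e3
    have hh' : AnalyticAt ℂ (deriv h) 0 := hh.deriv
    have : HasDerivAt (fun z => 2 * z * h z + z ^ 2 * deriv h z)
        ((2 * 1) * h 0 + 2 * 0 * deriv h 0 +
          ((2 : ℕ) * (0:ℂ) ^ (2 - 1) * deriv h 0 + 0 ^ 2 * deriv (deriv h) 0)) 0 :=
      (((hasDerivAt_id (0:ℂ)).const_mul 2).mul hh.differentiableAt.hasDerivAt).add
        ((hasDerivAt_pow 2 (0:ℂ)).mul hh'.differentiableAt.hasDerivAt)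
    rw [this.deriv] at e3
    simp at e3
    linear_combination (-1/2) * e3
  · filter_upwards [hev] with z hz
    simpa using hz

open Classical in
noncomputable def R (a z : ℂ) : ℂ :=
  if z ∈ L.lattice ∨ z + a ∈ L.lattice then 3 * L.sumInvPow a 4 else
    (L.weierstrassP z - L.weierstrassP a) * (L.weierstrassP (z + a) - L.weierstrassP a)

lemma mem_add_iff {z l : ℂ} (hl : l ∈ L.lattice) : z + l ∈ L.lattice ↔ z ∈ L.lattice :=
  L.lattice.add_mem_iff_left hl

lemma R_add_coe (a z : ℂ) {l : ℂ} (hl : l ∈ L.lattice) : R L a (z + l) = R L a z := by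
  have h1 := L.weierstrassP_add_coe z ⟨l, hl⟩
  have h2 := L.weierstrassP_add_coe (z + a) ⟨l, hl⟩
  simp only at h1 h2
  have h3 : z + l + a = z + a + l := by ring
  have i1 := mem_add_iff L (z := z) hl
  have i2 := mem_add_iff L (z := z + a) hl
  unfold R
  rw [h3, h1, h2]
  by_cases hz : z ∈ L.lattice ∨ z + a ∈ L.lattice
  · rw [if_pos hz, if_pos (by rwa [i1, i2])]
  · rw [if_neg hz, if_neg (by rwa [i1, i2])]

lemma R_add_half {a : ℂ} (h2a : 2 * a ∈ L.lattice) (z : ℂ) : R L a (z + a) = R L a z := by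
  have h2 := L.weierstrassP_add_coe z ⟨2 * a, h2a⟩
  simp only at h2
  have h3 : z + a + a = z + 2 * a := by ring
  unfold R
  rw [h3, h2, mul_comm (L.weierstrassP z - _)]
  have i := mem_add_iff L (z := z) h2a
  by_cases hz : z ∈ L.lattice ∨ z + a ∈ L.lattice
  · rw [if_pos hz, if_pos (by rwa [i, or_comm])]
  · rw [if_neg hz, if_neg (by rwa [i, or_comm])]

lemma R_analytic_zero {a : ℂ} (ha : a ∉ L.lattice) (h2a : 2 * a ∈ L.lattice) :
    AnalyticAt ℂ (R L a) 0 := by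
  obtain ⟨h, hh, h0, hev⟩ := wp_factor L ha h2a
  have hE : AnalyticAt ℂ (L.weierstrassPExcept 0) 0 := L.analyticAt_weierstrassPExcept 0
  have : AnalyticAt ℂ (fun z => (z ^ 2 * L.weierstrassPExcept 0 z + 1
      - z ^ 2 * L.weierstrassP a) * h z) 0 := by fun_prop
  refine this.congr ?_
  have hop : ∀ᶠ z in 𝓝 (0:ℂ), z + a ∉ L.lattice := by
    have : Tendsto (fun z : ℂ => z + a) (𝓝 0) (𝓝 a) := by
      have : Continuous (fun z : ℂ => z + a) := by fun_prop
      simpa using this.tendsto 0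
    exact this.eventually (L.isClosed_lattice.isOpen_compl.mem_nhds ha)
  filter_upwards [hev, hop, L.compl_lattice_sdiff_singleton_mem_nhds 0] with z hz hz2 hz3
  by_cases hz0 : z = 0
  · subst hz0
    simp [R, h0]
  have hzL : z ∉ L.lattice := by simp_all
  have hw := L.weierstrassPExcept_add 0 z
  simp at hw
  simp only [R, hzL, hz2, or_self, if_false, hz, ← hw]
  field_simp

lemma R_analytic {a : ℂ} (ha : a ∉ L.lattice) (h2a : 2 * a ∈ L.lattice) (z : ℂ) :
    AnalyticAt ℂ (R L a) z := by
  have hlat : ∀ z ∈ L.lattice, AnalyticAt ℂ (R L a) z := by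
    intro z hz
    have h := R_analytic_zero L ha h2a
    rw [← sub_self z] at h
    have h1 := h.comp (f := fun w => w - z) (by fun_prop)
    refine h1.congr (Eventually.of_forall fun w => ?_)
    have := R_add_coe L a (w - z) hz
    simp only [Function.comp]
    rw [← this, sub_add_cancel]
  by_cases hz : z ∈ L.lattice
  · exact hlat z hz
  by_cases hz2 : z + a ∈ L.lattice
  · have h := hlat _ hz2
    have h1 := h.comp (f := fun w => w + a) (by fun_prop)
    exact h1.congr (Eventually.of_forall fun w => R_add_half L h2a w)
  · have h1 := L.analyticOnNhd_weierstrassP z hz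
    have h2 : AnalyticAt ℂ (fun w => L.weierstrassP (w + a)) z := by
      have := L.analyticOnNhd_weierstrassP (z + a) hz2
      exact this.comp (f := fun w => w + a) (by fun_prop)
    have h3 : AnalyticAt ℂ (fun z => (L.weierstrassP z - L.weierstrassP a) *
      (L.weierstrassP (z + a) - L.weierstrassP a)) z := by fun_prop
    refine h3.congr ?_
    have c2 : Tendsto (fun z : ℂ => z + a) (𝓝 z) (𝓝 (z + a)) := by
      have : Continuous (fun z : ℂ => z + a) := by fun_prop
      exact this.tendsto z
    filter_upwards [L.isClosed_lattice.isOpen_compl.mem_nhds hz,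
      c2.eventually (L.isClosed_lattice.isOpen_compl.mem_nhds hz2)] with w hw hw2
    have hw' : w ∉ L.lattice := hw
    have hw2' : w + a ∉ L.lattice := hw2
    simp [R, hw', hw2']

lemma R_const {a : ℂ} (ha : a ∉ L.lattice) (h2a : 2 * a ∈ L.lattice) (z : ℂ) :
    R L a z = 3 * L.sumInvPow a 4 := by
  have : Differentiable ℂ (R L a) := fun x ↦ (R_analytic L ha h2a x).differentiableAt
  refine (this.apply_eq_apply_of_bounded (IsZLattice.isCompact_range_of_periodic L.lattice _
    this.continuous fun z w hw ↦ R_add_coe L a z hw).isBounded z 0).trans ?_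
  simp [R]

lemma wp_mul {a z : ℂ} (ha : a ∉ L.lattice) (h2a : 2 * a ∈ L.lattice) (hz : z ∉ L.lattice)
    (hz2 : z + a ∉ L.lattice) :
    (L.weierstrassP z - L.weierstrassP a) * (L.weierstrassP (z + a) - L.weierstrassP a)
      = 3 * L.sumInvPow a 4 := by
  rw [← R_const L ha h2a z]
  simp [R, hz, hz2]

lemma s_ne_zero {a : ℂ} (ha : a ∉ L.lattice) (h2a : 2 * a ∈ L.lattice) :
    L.sumInvPow a 4 ≠ 0 := by
  intro hs
  have hm : Meromorphic (fun z => L.weierstrassP z - L.weierstrassP a) := by fun_prop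
  have hord : ∀ l ∈ L.lattice,
      meromorphicOrderAt (fun z => L.weierstrassP z - L.weierstrassP a) l ≠ ⊤ := by
    intro l hl htop
    rw [meromorphicOrderAt_eq_top_iff] at htop
    have h1 := L.order_weierstrassP l hl
    have h2 : meromorphicOrderAt L.weierstrassP l =
        meromorphicOrderAt (fun _ => L.weierstrassP a) l := by
      apply meromorphicOrderAt_congr
      filter_upwards [htop] with z hz
      exact sub_eq_zero.mp hz
    have h3 : 0 ≤ meromorphicOrderAt (fun _ : ℂ => L.weierstrassP a) l :=
      (analyticAt_const).meromorphicOrderAt_nonneg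
    rw [← h2, h1] at h3
    exact absurd h3 (by decide)
  have hall : ∀ z, meromorphicOrderAt (fun z => L.weierstrassP z - L.weierstrassP a) z ≠ ⊤ := by
    have hm' : MeromorphicOn (fun z => L.weierstrassP z - L.weierstrassP a) Set.univ :=
      fun z _ => hm z
    have := (hm'.exists_meromorphicOrderAt_ne_top_iff_forall isConnected_univ).mp
      ⟨⟨0, trivial⟩, hord 0 L.lattice.zero_mem⟩
    exact fun z => this ⟨z, trivial⟩
  -- near zero the product vanishes
  have hne1 := (meromorphicOrderAt_ne_top_iff_eventually_ne_zero (hm 0)).mp (hall 0)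
  have hne2 := (meromorphicOrderAt_ne_top_iff_eventually_ne_zero (hm a)).mp (hall a)
  have ht : Tendsto (fun z : ℂ => z + a) (𝓝[≠] 0) (𝓝[≠] a) := by
    apply tendsto_nhdsWithin_of_tendsto_nhds_of_eventually_within
    · have : Continuous (fun z : ℂ => z + a) := by fun_prop
      simpa using (this.tendsto 0).mono_left nhdsWithin_le_nhds
    · filter_upwards [self_mem_nhdsWithin] with z hz
      simpa using hz
  have hop : ∀ᶠ z in 𝓝[≠] (0:ℂ), z + a ∉ L.lattice :=
    (ht.mono_right nhdsWithin_le_nhds).eventually (L.isClosed_lattice.isOpen_compl.mem_nhds ha)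
  have hz : ∀ᶠ z in 𝓝[≠] (0:ℂ), z ∉ L.lattice := by
    filter_upwards [self_mem_nhdsWithin, mem_nhdsWithin_of_mem_nhds
      (L.compl_lattice_sdiff_singleton_mem_nhds 0)] with w hw hw'
    simp_all
  obtain ⟨z, h1, h2, h3, h4⟩ := (hne1.and ((ht.eventually hne2).and (hop.and hz))).exists
  have := wp_mul L ha h2a h4 h3
  rw [hs, mul_zero] at this
  exact (mul_ne_zero h1 h2) this

lemma wp_sq {a : ℂ} (ha : a ∉ L.lattice) (h2a : 2 * a ∈ L.lattice) :
    12 * L.sumInvPow a 4 = 12 * L.weierstrassP a ^ 2 - L.g₂ := by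
  have hP : ∀ z ∉ L.lattice, HasDerivAt L.weierstrassP (L.derivWeierstrassP z) z := by
    intro z hz
    have := (L.analyticOnNhd_weierstrassP z hz).differentiableAt.hasDerivAt
    rwa [L.deriv_weierstrassP] at this
  have hP' : ∀ z ∉ L.lattice,
      HasDerivAt L.derivWeierstrassP (deriv L.derivWeierstrassP z) z := by
    intro z hz
    exact (L.analyticOnNhd_derivWeierstrassP z hz).differentiableAt.hasDerivAt
  have hnb : ∀ z ∉ L.lattice, ∀ᶠ w in 𝓝 z, w ∉ L.lattice := fun z hz =>
    L.isClosed_lattice.isOpen_compl.mem_nhds hz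
  have key : ∀ z ∉ L.lattice, L.derivWeierstrassP z *
      (2 * deriv L.derivWeierstrassP z - (12 * L.weierstrassP z ^ 2 - L.g₂)) = 0 := by
    intro z hz
    have e : (fun w => L.derivWeierstrassP w ^ 2) =ᶠ[𝓝 z]
        fun w => 4 * L.weierstrassP w ^ 3 - L.g₂ * L.weierstrassP w - L.g₃ := by
      filter_upwards [hnb z hz] with w hw using L.derivWeierstrassP_sq w hw
    have d1 := (hP' z hz).pow 2
    have d2 := ((((hP z hz).pow 3).const_mul 4).sub ((hP z hz).const_mul L.g₂)).sub_const L.g₃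
    have := (d1.congr_of_eventuallyEq e.symm).unique d2
    push_cast at this
    simp at this
    linear_combination this
  have hP'' : AnalyticAt ℂ (deriv L.derivWeierstrassP) a :=
    (L.analyticOnNhd_derivWeierstrassP a ha).deriv
  have d := (hP' a ha).mul ((hP''.differentiableAt.hasDerivAt.const_mul 2).sub
    ((((hP a ha).pow 2).const_mul 12).sub_const L.g₂))
  have e : (fun _ => (0:ℂ)) =ᶠ[𝓝 a] fun z => L.derivWeierstrassP z *
      (2 * deriv L.derivWeierstrassP z - (12 * L.weierstrassP z ^ 2 - L.g₂)) := by
    filter_upwards [hnb a ha] with w hw using (key w hw).symm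
  have := (d.congr_of_eventuallyEq e).unique (hasDerivAt_const a (0:ℂ))
  simp only [wp_half_deriv L h2a, zero_mul, add_zero, wp_deriv2 L ha, Pi.pow_apply, Pi.sub_apply] at this
  have hs := s_ne_zero L ha h2a
  have h6 : 6 * L.sumInvPow a 4 ≠ 0 := mul_ne_zero (by norm_num) hs
  have := (mul_eq_zero.mp this).resolve_left h6
  linear_combination this

lemma half_identity {a b : ℂ} (ha : a ∉ L.lattice) (h2a : 2 * a ∈ L.lattice)
    (hb : b ∉ L.lattice) (h2b : 2 * b ∈ L.lattice) (hab : b + a ∉ L.lattice) :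
    (L.weierstrassP b - L.weierstrassP (b + a)) ^ 2 = 45 * L.G 4 - 3 * L.sumInvPow a 4 := by
  have h1 := wp_mul L ha h2a hb hab
  have h2 := wp_sq L ha h2a
  have hs := s_ne_zero L ha h2a
  have pa := L.derivWeierstrassP_sq a ha
  have pb := L.derivWeierstrassP_sq b hb
  rw [wp_half_deriv L h2a] at pa
  rw [wp_half_deriv L h2b] at pb
  have hg : L.g₂ = 60 * L.G 4 := rfl
  set x := L.weierstrassP a
  set y := L.weierstrassP b
  set w := L.weierstrassP (b + a)
  set s := L.sumInvPow a 4
  have hne : y - x ≠ 0 := by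
    intro h
    rw [h, zero_mul] at h1
    exact hs (by linear_combination (-1/3) * h1)
  have k1 : 4 * (x ^ 2 + x * y + y ^ 2) = L.g₂ := by
    apply mul_left_cancel₀ hne
    linear_combination pa - pb
  have k2 : w = -x - y := by
    apply mul_left_cancel₀ hne
    linear_combination h1 + (1/4) * h2 + (1/4) * k1
  rw [k2]
  linear_combination k1 + (1/4) * h2 + (3/4) * hg

/-- The period pair `(1, τ)`. -/
noncomputable def pp (τ : ℂ) (hτ : 0 < τ.im) : PeriodPair where
  ω₁ := 1
  ω₂ := τ
  indep := by
    rw [LinearIndependent.pair_iff]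
    intro s t h
    have h1 := congrArg Complex.im h
    have h2 := congrArg Complex.re h
    simp at h1 h2
    have ht : t = 0 := h1.resolve_right hτ.ne'
    subst ht
    simpa using h2

lemma pp_symm (τ : ℂ) (hτ : 0 < τ.im) (p : ℤ × ℤ) :
    ((pp τ hτ).latticeEquivProd.symm p : ℂ) = p.1 + p.2 * τ := by
  rw [latticeEquiv_symm_apply]; simp [pp]

lemma wpt_half (τ : ℂ) (hτ : 0 < τ.im) :
    wpt (1 / 2) τ = (Real.pi : ℂ)⁻¹ ^ 2 *
      ((pp τ hτ).weierstrassP (τ / 2) - (pp τ hτ).weierstrassP (τ / 2 + 1 / 2)) := by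
  have h1 := ((pp τ hτ).hasSum_weierstrassP (τ / 2 + 1)).sub
    ((pp τ hτ).hasSum_weierstrassP (τ / 2 + 1 / 2))
  have hper : (pp τ hτ).weierstrassP (τ / 2 + 1) = (pp τ hτ).weierstrassP (τ / 2) :=
    (pp τ hτ).weierstrassP_add_coe (τ / 2) ⟨1, (pp τ hτ).ω₁_mem_lattice⟩
  rw [hper] at h1
  rw [wpt, ← h1.tsum_eq,
    ← ((Equiv.neg (ℤ × ℤ)).trans (pp τ hτ).latticeEquivProd.symm.toEquiv).tsum_eq]
  congr 1
  apply tsum_congr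
  intro p
  have : ((((Equiv.neg (ℤ × ℤ)).trans (pp τ hτ).latticeEquivProd.symm.toEquiv) p : 
      (pp τ hτ).lattice) : ℂ) = -(p.1 + p.2 * τ) := by
    have := pp_symm τ hτ (-p)
    simp only [Equiv.trans_apply, Equiv.neg_apply, LinearEquiv.coe_toEquiv, this]
    simp; ring
  rw [this]
  have e1 : τ / 2 + 1 - -((p.1:ℂ) + p.2 * τ) = 1 / 2 + (p.1 + 1 / 2) + (p.2 + 1 / 2) * τ := by ring
  have e2 : τ / 2 + 1 / 2 - -((p.1:ℂ) + p.2 * τ) = (p.1 + 1 / 2) + (p.2 + 1 / 2) * τ := by ring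
  rw [e1, e2]
  ring

lemma hasSum_G (τ : ℂ) (hτ : 0 < τ.im) :
    HasSum (fun p : ℤ × ℤ => (((p.1 : ℂ) + p.2 * τ) ^ 4)⁻¹) ((pp τ hτ).G 4) := by
  have h := (pp τ hτ).hasSum_sumInvPow 0 (r := 4) (by norm_num)
  rw [sumInvPow_zero, ← (pp τ hτ).latticeEquivProd.symm.toEquiv.hasSum_iff] at h
  convert h using 2 with p
  simp only [Function.comp, LinearEquiv.coe_toEquiv, pp_symm, sub_zero]

lemma hasSum_s (τ : ℂ) (hτ : 0 < τ.im) :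
    HasSum (fun p : ℤ × ℤ => (((p.1 : ℂ) + p.2 * τ - 1 / 2) ^ 4)⁻¹)
      ((pp τ hτ).sumInvPow (1 / 2) 4) := by
  have h := (pp τ hτ).hasSum_sumInvPow (1 / 2) (r := 4) (by norm_num)
  rw [← (pp τ hτ).latticeEquivProd.symm.toEquiv.hasSum_iff] at h
  convert h using 2 with p
  simp only [Function.comp, LinearEquiv.coe_toEquiv, pp_symm]

lemma im_two {τ : ℂ} (hτ : 0 < τ.im) : 0 < (2 * τ).im := by simpa using hτ

lemma s_eq (τ : ℂ) (hτ : 0 < τ.im) :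
    (pp τ hτ).sumInvPow (1 / 2) 4 = 16 * (pp (2 * τ) (im_two hτ)).G 4 - (pp τ hτ).G 4 := by
  have hE : Function.Injective (fun p : ℤ × ℤ => ((2 * p.1, p.2) : ℤ × ℤ)) := by
    rintro ⟨a, b⟩ ⟨c, d⟩ h
    simp at h ⊢; omega
  have hO : Function.Injective (fun p : ℤ × ℤ => ((2 * p.1 - 1, p.2) : ℤ × ℤ)) := by
    rintro ⟨a, b⟩ ⟨c, d⟩ h
    simp at h ⊢; omega
  have hc : IsCompl (Set.range (fun p : ℤ × ℤ => ((2 * p.1, p.2) : ℤ × ℤ)))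
      (Set.range (fun p : ℤ × ℤ => ((2 * p.1 - 1, p.2) : ℤ × ℤ))) := by
    refine ⟨Set.disjoint_left.mpr ?_, codisjoint_iff_le_sup.mpr ?_⟩
    · rintro _ ⟨p, rfl⟩ ⟨q, hq⟩
      simp at hq; omega
    · rintro ⟨m, n⟩ -
      obtain ⟨k, hk | hk⟩ := Int.even_or_odd' m
      · exact Or.inl ⟨(k, n), by simp [hk]⟩
      · refine Or.inr ⟨(k + 1, n), ?_⟩
        simp [hk]; ring
  have h1 := (hasSum_G τ hτ).mul_left (1 / 16)
  have h2 := (hasSum_s τ hτ).mul_left (1 / 16)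
  let f : ℤ × ℤ → ℂ := fun p => (((p.1 : ℂ) + p.2 * (2 * τ)) ^ 4)⁻¹
  have h1' : HasSum (f ∘ (fun p : ℤ × ℤ => ((2 * p.1, p.2) : ℤ × ℤ)))
      (1 / 16 * (pp τ hτ).G 4) := by
    refine (congrArg (fun g => HasSum g _) (funext fun p => ?_)).mpr h1
    change (((((2 * p.1 : ℤ)) : ℂ) + p.2 * (2 * τ)) ^ 4)⁻¹ = _
    push_cast
    rw [show (2 * (p.1:ℂ) + p.2 * (2 * τ)) = 2 * (p.1 + p.2 * τ) by ring, mul_pow, mul_inv]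
    norm_num
  have h2' : HasSum (f ∘ (fun p : ℤ × ℤ => ((2 * p.1 - 1, p.2) : ℤ × ℤ)))
      (1 / 16 * (pp τ hτ).sumInvPow (1 / 2) 4) := by
    refine (congrArg (fun g => HasSum g _) (funext fun p => ?_)).mpr h2
    change (((((2 * p.1 - 1 : ℤ)) : ℂ) + p.2 * (2 * τ)) ^ 4)⁻¹ = _
    push_cast
    rw [show (2 * (p.1:ℂ) - 1 + p.2 * (2 * τ)) = 2 * (p.1 + p.2 * τ - 1 / 2) by ring,
      mul_pow, mul_inv]
    norm_num
  have h3 : HasSum f _ := HasSum.add_isCompl (f := f) hc (hE.hasSum_range_iff.mpr h1')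
    (hO.hasSum_range_iff.mpr h2')
  have := h3.unique (hasSum_G (2 * τ) (im_two hτ))
  linear_combination 16 * this

lemma wpt_sq (τ : ℂ) (hτ : 0 < τ.im) :
    wpt (1 / 2) τ ^ 2 = (Real.pi : ℂ)⁻¹ ^ 4 * 48 *
      ((pp τ hτ).G 4 - (pp (2 * τ) (im_two hτ)).G 4) := by
  have ha : (1 / 2 : ℂ) ∉ (pp τ hτ).lattice := (pp τ hτ).ω₁_div_two_notMem_lattice
  have hb : τ / 2 ∉ (pp τ hτ).lattice := (pp τ hτ).ω₂_div_two_notMem_lattice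
  have h2a : 2 * (1 / 2 : ℂ) ∈ (pp τ hτ).lattice := by
    have := (pp τ hτ).ω₁_mem_lattice
    rw [show 2 * (1 / 2 : ℂ) = 1 by norm_num]; exact this
  have h2b : 2 * (τ / 2) ∈ (pp τ hτ).lattice := by
    have := (pp τ hτ).ω₂_mem_lattice
    rw [show 2 * (τ / 2) = τ by ring]; exact this
  have hab : τ / 2 + 1 / 2 ∉ (pp τ hτ).lattice := by
    have h := ((pp τ hτ).mul_ω₁_add_mul_ω₂_mem_lattice (α := 1 / 2) (β := 1 / 2)).not.mpr
      (by norm_num)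
    have e : (((1 / 2 : ℚ) : ℂ) * (pp τ hτ).ω₁ + ((1 / 2 : ℚ) : ℂ) * (pp τ hτ).ω₂)
      = τ / 2 + 1 / 2 := by
      simp [pp]; ring
    rwa [e] at h
  have h := half_identity (pp τ hτ) ha h2a hb h2b hab
  rw [wpt_half τ hτ, mul_pow, h, s_eq τ hτ]
  ring

lemma G_eq_E4 (τ : UpperHalfPlane) :
    (pp τ τ.im_pos).G 4 = 2 * riemannZeta 4 * ModularForm.E₄ τ := by
  have h := tsum_eisSummand_eq_riemannZeta_mul_eisensteinSeries
    (k := 4) (by norm_num) τ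
  have hE : ModularForm.E₄ τ = (1 / 2 : ℂ) * eisensteinSeries (N := 1) 0 4 τ := rfl
  rw [hE, ← (hasSum_G τ τ.im_pos).tsum_eq]
  have h2 : ∑' v : Fin 2 → ℤ, EisensteinSeries.eisSummand 4 v τ =
      ∑' p : ℤ × ℤ, (((p.1 : ℂ) + p.2 * τ) ^ 4)⁻¹ := by
    rw [← ((finTwoArrowEquiv ℤ).trans (Equiv.prodComm ℤ ℤ)).tsum_eq
      (fun p : ℤ × ℤ => (((p.1 : ℂ) + p.2 * τ) ^ 4)⁻¹)]
    refine tsum_congr fun v => ?_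
    simp only [EisensteinSeries.eisSummand, Equiv.trans_apply, Equiv.prodComm_apply,
      finTwoArrowEquiv_apply, Prod.swap]
    rw [add_comm, zpow_neg]
    norm_cast
  push_cast at h
  rw [← h2, h]
  ring

open MatrixGroups ModularForm in
/-- Restriction of a modular form to a smaller group. -/
noncomputable def restr {Γ Γ' : Subgroup (GL (Fin 2) ℝ)} {k : ℤ} (h : Γ' ≤ Γ)
    (f : ModularForm Γ k) : ModularForm Γ' k where
  toFun := f
  slash_action_eq' γ hγ := f.slash_action_eq' γ (h hγ)
  holo' := f.holo'
  bdd_at_cusps' hc := f.bdd_at_cusps' (hc.mono h)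

/-- The matrix `diag(2,1)`. -/
noncomputable def dg : GL (Fin 2) ℝ :=
  Matrix.GeneralLinearGroup.mkOfDetNeZero !![2, 0; 0, 1] (by simp)

open MatrixGroups ModularForm in
lemma gamma0_le_SL :
    ((CongruenceSubgroup.Gamma0 2 : Subgroup SL(2, ℤ)) : Subgroup (GL (Fin 2) ℝ)) ≤ 𝒮ℒ := by
  rintro _ ⟨γ, -, rfl⟩
  exact ⟨γ, rfl⟩

open MatrixGroups ModularForm ConjAct Pointwise in
lemma gamma0_le_conj :
    ((CongruenceSubgroup.Gamma0 2 : Subgroup SL(2, ℤ)) : Subgroup (GL (Fin 2) ℝ)) ≤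
      toConjAct dg⁻¹ • 𝒮ℒ := by
  rintro _ ⟨γ, hγ, rfl⟩
  rw [Subgroup.mem_pointwise_smul_iff_inv_smul_mem]
  have h : ((γ 1 0 : ℤ) : ZMod 2) = 0 := CongruenceSubgroup.Gamma0_mem.mp hγ
  obtain ⟨c, hc⟩ := (ZMod.intCast_zmod_eq_zero_iff_dvd _ _).mp h
  have hdet := γ.det_coe
  rw [Matrix.det_fin_two] at hdet
  push_cast at hc
  obtain ⟨δ, d00, d01, d10, d11⟩ : ∃ δ : SL(2, ℤ), δ 0 0 = γ 0 0 ∧ δ 0 1 = 2 * γ 0 1 ∧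
      δ 1 0 = c ∧ δ 1 1 = γ 1 1 := by
    refine ⟨⟨!![γ 0 0, 2 * γ 0 1; c, γ 1 1], ?_⟩, rfl, rfl, rfl, rfl⟩
    rw [Matrix.det_fin_two]
    simp
    rw [hc] at hdet
    linarith
  have hm : ∀ (g : SL(2, ℤ)) (i j : Fin 2),
      ((Matrix.SpecialLinearGroup.mapGL ℝ g : GL (Fin 2) ℝ) : Matrix (Fin 2) (Fin 2) ℝ) i j
        = ((g i j : ℤ) : ℝ) := fun g i j => rfl
  refine ⟨δ, ?_⟩
  rw [← map_inv, inv_inv, toConjAct_smul, eq_mul_inv_iff_mul_eq]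
  ext i j
  rw [Matrix.GeneralLinearGroup.coe_mul, Matrix.GeneralLinearGroup.coe_mul, Matrix.mul_apply,
    Matrix.mul_apply]
  simp only [hm, Fin.sum_univ_two]
  fin_cases i <;> fin_cases j <;> simp [dg, hc, d00, d01, d10, d11] <;> ring

open MatrixGroups ModularForm in
noncomputable def E4two : ModularForm (CongruenceSubgroup.Gamma0 2) 4 :=
  restr gamma0_le_conj (ModularForm.translate ModularForm.E₄ dg)

open MatrixGroups ModularForm in
lemma E4two_apply (τ : UpperHalfPlane) (τ' : UpperHalfPlane) (h : (τ' : ℂ) = 2 * τ) :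
    E4two τ = 8 * ModularForm.E₄ τ' := by
  change (⇑ModularForm.E₄ ∣[(4:ℤ)] dg) τ = _
  rw [slash_apply]
  have hdet : dg.det.val = 2 := by simp [dg]
  have hσ : UpperHalfPlane.σ dg = ContinuousAlgEquiv.refl ℝ ℂ := by
    simp [UpperHalfPlane.σ, hdet]
  have hden : UpperHalfPlane.denom dg τ = 1 := by simp [UpperHalfPlane.denom, dg]
  have hsm : dg • τ = τ' := by
    apply UpperHalfPlane.ext
    rw [h, UpperHalfPlane.coe_smul_of_det_pos (by rw [hdet]; norm_num), hden]
    simp [UpperHalfPlane.num, dg]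
  rw [hσ, hden, hsm, hdet]
  norm_num
  ring

end Delta2

open Delta2
open UpperHalfPlane in
/-- `℘̃a(1/2, τ/(4τ+1))² = (4τ+1)⁴ ℘̃a(1/2, τ)²`; consequently the strong modular unit
`Δ₂(τ) = (1/256) ℘̃a(1/2,τ)²` is a modular form of weight 4 for `Γ₀(2)`. -/
theorem delta2_gamma0_two :
    (∀ τ : ℂ, 0 < τ.im →
        wpt (1 / 2) (τ / (4 * τ + 1)) ^ 2 = (4 * τ + 1) ^ 4 * wpt (1 / 2) τ ^ 2) ∧
      ∃ f : ModularForm (CongruenceSubgroup.Gamma0 2) 4,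
        ∀ τ : UpperHalfPlane, f τ = 1 / 256 * wpt (1 / 2) (τ : ℂ) ^ 2 := by
  have main : ∃ f : ModularForm (CongruenceSubgroup.Gamma0 2) 4,
        ∀ τ : UpperHalfPlane, f τ = 1 / 256 * wpt (1 / 2) (τ : ℂ) ^ 2 := by
    refine ⟨(1 / 256 * (Real.pi : ℂ)⁻¹ ^ 4 * 48 * (2 * riemannZeta 4)) •
      (restr gamma0_le_SL ModularForm.E₄ - (1 / 8 : ℂ) • E4two), fun τ => ?_⟩
    rw [wpt_sq τ τ.im_pos]
    have h1 := G_eq_E4 τ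
    have h2 := G_eq_E4 ⟨2 * τ, im_two τ.im_pos⟩
    have h3 := E4two_apply τ ⟨2 * τ, im_two τ.im_pos⟩ rfl
    have h4 : (restr gamma0_le_SL ModularForm.E₄) τ = ModularForm.E₄ τ := rfl
    change _ * ((restr gamma0_le_SL ModularForm.E₄) τ - (1 / 8 : ℂ) * E4two τ) = _
    rw [h3, h4]
    change _ = 1 / 256 * (_ * ((pp τ τ.im_pos).G 4 - _))
    rw [h1]
    erw [h2]
    ring
  refine ⟨?_, main⟩
  obtain ⟨f, hf⟩ := main
  intro τ hτ
  let γ : Matrix.SpecialLinearGroup (Fin 2) ℤ := ⟨!![1, 0; 4, 1], by simp⟩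
  have hγ : γ ∈ CongruenceSubgroup.Gamma0 2 := by
    rw [CongruenceSubgroup.Gamma0_mem]
    simp [γ]; rfl
  have h := SlashInvariantForm.slash_action_eqn_SL'' f hγ ⟨τ, hτ⟩
  have e1 : ((γ • (⟨τ, hτ⟩ : ℍ) : ℍ) : ℂ) = τ / (4 * τ + 1) := by
    rw [UpperHalfPlane.specialLinearGroup_apply]
    simp [γ]
  have e2 : denom γ (⟨τ, hτ⟩ : ℍ) = 4 * τ + 1 := by
    change ((((4 : ℤ) : ℝ) : ℂ) * τ + (((1 : ℤ) : ℝ) : ℂ)) = _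
    push_cast; ring
  rw [hf, hf, e1, e2] at h
  have h' : 1 / 256 * wpt (1 / 2) (τ / (4 * τ + 1)) ^ 2 =
    (4 * τ + 1) ^ 4 * (1 / 256 * wpt (1 / 2) τ ^ 2) := h
  linear_combination 256 * h'
end

section
/- For every τ in the upper half-plane H, ℘̃a(1/2, 2τ) = π^{−2} Σ_{(n,m)∈ℤ²} (1/(n+(2m+1)τ)² − 1/((n+1/2)+(2m+1)τ)²) = −8i Σ_{m odd, m ≥ 1} m / sin(2mπτ), the last series converging absolutely. -/
open Complex

/-- The full lattice-row sum. -/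
noncomputable def rowA (w : ℂ) : ℂ := ∑' n : ℤ, 1 / ((n : ℂ) + w) ^ 2

lemma rowA_summable (w : ℂ) : Summable (fun n : ℤ => 1 / ((n : ℂ) + w) ^ 2) := by
  have h := EisensteinSeries.linear_right_summable w 1 (k := 2) le_rfl
  refine h.congr fun n => ?_
  norm_cast
  simp [add_comm]

lemma rowA_neg (w : ℂ) : rowA (-w) = rowA w := by
  unfold rowA
  rw [← (Equiv.neg ℤ).tsum_eq]
  refine tsum_congr fun n => ?_
  simp only [Equiv.neg_apply, Int.cast_neg]
  rw [← neg_add, neg_sq]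

lemma rowA_add_one (w : ℂ) : rowA (w + 1) = rowA w := by
  unfold rowA
  rw [← (Equiv.addRight (1 : ℤ)).tsum_eq (fun n : ℤ => 1 / ((n : ℂ) + w) ^ 2)]
  refine tsum_congr fun n => ?_
  simp only [Equiv.coe_addRight, Int.cast_add, Int.cast_one]
  ring_nf

lemma rowA_eq (w : ℂ) (hw : 0 < w.im) :
    rowA w = -4 * (Real.pi : ℂ) ^ 2 * ∑' n : ℕ, (n : ℂ) * cexp (2 * Real.pi * I * w) ^ n := by
  have h := EisensteinSeries.qExpansion_identity (k := 1) le_rfl ⟨w, hw⟩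
  have h2 : rowA w = ∑' n : ℤ, 1 / (w + n) ^ (1 + 1) := by
    unfold rowA
    simp [add_comm]
  rw [h2]
  refine h.trans ?_
  simp only [pow_one, Nat.factorial_one, Nat.cast_one, div_one, UpperHalfPlane.coe_mk]
  congr 1
  ring_nf
  simp

lemma norm_q_lt (w : ℂ) (hw : 0 < w.im) : ‖cexp (2 * Real.pi * I * w)‖ < 1 :=
  UpperHalfPlane.norm_exp_two_pi_I_lt_one ⟨w, hw⟩

lemma q_summable (q : ℂ) (hq : ‖q‖ < 1) : Summable (fun n : ℕ => (n : ℂ) * q ^ n) := by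
  simpa using (summable_norm_pow_mul_geometric_of_norm_lt_one 1 hq).of_norm

lemma row_diff (w : ℂ) (hw : 0 < w.im) :
    rowA w - rowA (w + 1 / 2) = -8 * (Real.pi : ℂ) ^ 2 *
      ∑' j : ℕ, (2 * (j : ℂ) + 1) * cexp (2 * Real.pi * I * w) ^ (2 * j + 1) := by
  rw [rowA_eq w hw, rowA_eq (w + 1 / 2) (by simpa using hw)]
  have e : cexp (2 * Real.pi * I * (w + 1 / 2)) = - cexp (2 * Real.pi * I * w) := by
    rw [show 2 * Real.pi * I * (w + 1 / 2) = 2 * Real.pi * I * w + Real.pi * I by ring,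
      Complex.exp_add, Complex.exp_pi_mul_I]
    ring
  rw [e]
  have hq := norm_q_lt w hw
  set q := cexp (2 * Real.pi * I * w)
  have s1 := q_summable q hq
  have s2 := q_summable (-q) (by simpa using hq)
  rw [← mul_sub, ← s1.tsum_sub s2]
  have s3 := s1.sub s2
  rw [← tsum_even_add_odd (f := fun n : ℕ => (n : ℂ) * q ^ n - (n : ℂ) * (-q) ^ n)
    (s3.comp_injective (i := fun k => 2 * k) (fun a b h => by simpa using h))
    (s3.comp_injective (i := fun k => 2 * k + 1) (fun a b h => by simpa using h))]
  have z : ∀ k : ℕ, ((2 * k : ℕ) : ℂ) * q ^ (2 * k) - ((2 * k : ℕ) : ℂ) * (-q) ^ (2 * k) = 0 := by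
    intro k
    rw [Even.neg_pow (even_two_mul k), sub_self]
  have o : ∀ k : ℕ, ((2 * k + 1 : ℕ) : ℂ) * q ^ (2 * k + 1)
      - ((2 * k + 1 : ℕ) : ℂ) * (-q) ^ (2 * k + 1) = 2 * ((2 * (k : ℂ) + 1) * q ^ (2 * k + 1)) := by
    intro k
    rw [Odd.neg_pow (odd_two_mul_add_one k)]
    push_cast
    ring
  simp only [z, o, tsum_zero, zero_add, tsum_mul_left]
  ring

lemma row_tsum (w : ℂ) : ∑' n : ℤ, (1 / ((n : ℂ) + w) ^ 2 - 1 / (((n : ℂ) + 1 / 2) + w) ^ 2) =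
    rowA w - rowA (w + 1 / 2) := by
  unfold rowA
  rw [← (rowA_summable w).tsum_sub (rowA_summable (w + 1 / 2))]
  refine tsum_congr fun n => ?_
  rw [show (n : ℂ) + 1 / 2 + w = n + (w + 1 / 2) by ring]

lemma cube_summable (τ : ℂ) (hτ : 0 < τ.im) (e : ℤ) :
    Summable (fun p : ℤ × ℤ =>
      ‖(2 * (p.1 : ℂ) + e) + (4 * (p.2 : ℂ) + 2) * τ‖⁻¹ ^ 3) := by
  have h := EisensteinSeries.summable_norm_eisSummand (k := 3) le_rfl ⟨τ, hτ⟩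
  have inj : Function.Injective
      (fun p : ℤ × ℤ => (![4 * p.2 + 2, 2 * p.1 + e] : Fin 2 → ℤ)) := by
    rintro ⟨a, b⟩ ⟨c, d⟩ h
    have h0 := congrFun h 0
    have h1 := congrFun h 1
    simp at h0 h1
    simp [h0, h1]
  refine (h.comp_injective inj).congr fun p => ?_
  simp only [Function.comp, EisensteinSeries.eisSummand, UpperHalfPlane.coe_mk]
  rw [norm_zpow, zpow_neg, inv_pow]
  norm_cast
  simp
  ring_nf

lemma F_summable (τ : ℂ) (hτ : 0 < τ.im) :
    Summable (fun p : ℤ × ℤ => (1 / ((p.1 : ℂ) + (2 * (p.2 : ℂ) + 1) * τ) ^ 2 -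
              1 / (((p.1 : ℂ) + 1 / 2) + (2 * (p.2 : ℂ) + 1) * τ) ^ 2)) := by
  have h0 := cube_summable τ hτ 0
  have h1 := cube_summable τ hτ 1
  refine Summable.of_norm_bounded ((h0.add h1).mul_left 8) fun p => ?_
  have im0 : ∀ r : ℝ, ((r : ℂ) + (4 * (p.2 : ℂ) + 2) * τ) ≠ 0 := by
    intro r h
    have h2 := congrArg Complex.im h
    have h3 : (4 * (p.2 : ℂ) + 2) = ((4 * p.2 + 2 : ℝ) : ℂ) := by push_cast; ring
    rw [h3] at h2
    simp only [add_im, ofReal_im, im_ofReal_mul, zero_im, zero_add] at h2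
    rcases mul_eq_zero.1 h2 with h4 | h4
    · have : (4 * p.2 + 2 : ℤ) = 0 := by exact_mod_cast h4
      omega
    · exact hτ.ne' h4
  have ha := im0 (2 * p.1 + (0 : ℤ))
  have hb := im0 (2 * p.1 + (1 : ℤ))
  push_cast at ha hb
  simp only [Int.cast_zero, Int.cast_one]
  set a : ℂ := 2 * (p.1 : ℂ) + 0 + (4 * (p.2 : ℂ) + 2) * τ with hadef
  set b : ℂ := 2 * (p.1 : ℂ) + 1 + (4 * (p.2 : ℂ) + 2) * τ with hbdef
  have ea : (p.1 : ℂ) + (2 * (p.2 : ℂ) + 1) * τ = a / 2 := by rw [hadef]; ring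
  have eb : (p.1 : ℂ) + 1 / 2 + (2 * (p.2 : ℂ) + 1) * τ = b / 2 := by rw [hbdef]; ring
  have hab : b - a = 1 := by rw [hadef, hbdef]; ring
  rw [ea, eb]
  have key : 1 / (a / 2) ^ 2 - 1 / (b / 2) ^ 2 = 4 * (a⁻¹ * b⁻¹ ^ 2 + a⁻¹ ^ 2 * b⁻¹) := by
    have hb' : b = a + 1 := by rw [← hab]; ring
    rw [hb'] at hb ⊢
    field_simp
    ring
  rw [key]
  have hn : ‖4 * (a⁻¹ * b⁻¹ ^ 2 + a⁻¹ ^ 2 * b⁻¹)‖ ≤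
      4 * (‖a‖⁻¹ * ‖b‖⁻¹ ^ 2 + ‖a‖⁻¹ ^ 2 * ‖b‖⁻¹) := by
    rw [norm_mul]
    refine (mul_le_mul_of_nonneg_left (norm_add_le _ _) (norm_nonneg _)).trans ?_
    simp
  refine hn.trans ?_
  have x0 : 0 ≤ ‖a‖⁻¹ := by positivity
  have y0 : 0 ≤ ‖b‖⁻¹ := by positivity
  generalize ‖a‖⁻¹ = x at *
  generalize ‖b‖⁻¹ = y at *
  nlinarith [mul_nonneg (add_nonneg x0 y0) (sq_nonneg (x - y)), pow_nonneg x0 3, pow_nonneg y0 3]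

lemma double_summable (x : ℂ) (hx : ‖x‖ < 1) :
    Summable (fun p : ℕ × ℕ => (2 * (p.1 : ℂ) + 1) * (x ^ (2 * p.2 + 1)) ^ (2 * p.1 + 1)) := by
  have h1 : Summable (fun j : ℕ => (2 * (j : ℝ) + 1) * ‖x‖ ^ j) := by
    have a := summable_norm_pow_mul_geometric_of_norm_lt_one 1 (r := ‖x‖) (by simpa using hx)
    have b := summable_geometric_of_lt_one (norm_nonneg x) hx
    refine ((a.mul_left 2).add b).congr fun j => ?_
    simp
    ring
  have b := summable_geometric_of_lt_one (norm_nonneg x) hx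
  have h2 := h1.mul_of_nonneg b (fun j => by positivity) (fun j => by positivity)
  refine Summable.of_norm_bounded h2 fun p => ?_
  have e : ‖(2 * (p.1 : ℂ) + 1)‖ = 2 * (p.1 : ℝ) + 1 := by
    have : (2 * (p.1 : ℂ) + 1) = ((2 * p.1 + 1 : ℕ) : ℂ) := by push_cast; ring
    rw [this, Complex.norm_natCast]
    push_cast
    ring
  rw [norm_mul, e, norm_pow, norm_pow, mul_assoc, ← pow_mul, ← pow_add]
  refine mul_le_mul_of_nonneg_left ?_ (by positivity)
  exact pow_le_pow_of_le_one (norm_nonneg x) hx.le (by nlinarith [Nat.zero_le (p.1 * p.2)])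

lemma geom_row (τ : ℂ) (hτ : 0 < τ.im) (j : ℕ) :
    ∑' m : ℕ, (2 * (j : ℂ) + 1) * (cexp (2 * Real.pi * I * τ) ^ (2 * m + 1)) ^ (2 * j + 1) =
      I / 2 * ((2 * (j : ℂ) + 1) / Complex.sin (2 * (2 * (j : ℂ) + 1) * (Real.pi : ℂ) * τ)) := by
  have hx := norm_q_lt τ hτ
  set x := cexp (2 * Real.pi * I * τ) with hxd
  have hx0 : x ≠ 0 := Complex.exp_ne_zero _
  set y := x ^ (2 * j + 1) with hy
  have hyn : ‖y‖ < 1 := by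
    rw [hy, norm_pow]
    exact pow_lt_one₀ (norm_nonneg _) hx (by omega)
  have hy0 : y ≠ 0 := pow_ne_zero _ hx0
  have hy2 : ‖y ^ 2‖ < 1 := by
    rw [norm_pow]
    exact pow_lt_one₀ (norm_nonneg _) hyn (by omega)
  have e1 : ∀ m : ℕ, (2 * (j : ℂ) + 1) * (x ^ (2 * m + 1)) ^ (2 * j + 1) =
      ((2 * (j : ℂ) + 1) * y) * (y ^ 2) ^ m := by
    intro m
    rw [hy]
    ring
  simp only [e1]
  rw [tsum_mul_left, tsum_geometric_of_norm_lt_one hy2]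
  have hyexp : y = cexp (2 * (2 * (j : ℂ) + 1) * (Real.pi : ℂ) * τ * I) := by
    rw [hy, hxd, ← Complex.exp_nat_mul]
    congr 1
    push_cast
    ring
  have hsin : Complex.sin (2 * (2 * (j : ℂ) + 1) * (Real.pi : ℂ) * τ) = (y⁻¹ - y) * I / 2 := by
    rw [Complex.sin, hyexp, ← Complex.exp_neg]
    ring_nf
  have h1 : 1 - y ^ 2 ≠ 0 := by
    intro h
    have : y ^ 2 = 1 := by linear_combination -h
    rw [this] at hy2
    simp at hy2
  rw [hsin]
  have h3 : y⁻¹ - y = (1 - y ^ 2) / y := by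
    field_simp
  rw [h3]
  field_simp

lemma sin_series_summable (τ : ℂ) (hτ : 0 < τ.im) : Summable (fun n : ℕ =>
    (2 * (n : ℂ) + 1) / Complex.sin (2 * (2 * (n : ℂ) + 1) * (Real.pi : ℂ) * τ)) := by
  have h := (double_summable _ (norm_q_lt τ hτ)).prod
  simp only [geom_row τ hτ] at h
  refine (h.mul_left (-2 * I)).congr fun n => ?_
  linear_combination (-((2 * (n : ℂ) + 1) / Complex.sin (2 * (2 * (n : ℂ) + 1) * (Real.pi : ℂ) * τ))) * I_sq

/-- Difference of the two row sums on the row of index `m`. -/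
noncomputable def rowG (τ : ℂ) (m : ℤ) : ℂ :=
  rowA ((2 * (m : ℂ) + 1) * τ) - rowA ((2 * (m : ℂ) + 1) * τ + 1 / 2)

lemma fubini_rows (F : ℤ × ℤ → ℂ) (G : ℤ → ℂ) (hF : Summable F)
    (hG : ∀ m, ∑' n : ℤ, F (n, m) = G m) :
    Summable G ∧ ∑' p : ℤ × ℤ, F p = ∑' m : ℤ, G m := by
  have hF' : Summable (fun p : ℤ × ℤ => F (p.2, p.1)) := (Equiv.prodComm ℤ ℤ).summable_iff.2 hF
  have e : ∑' p : ℤ × ℤ, F (p.2, p.1) = ∑' p : ℤ × ℤ, F p := (Equiv.prodComm ℤ ℤ).tsum_eq F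
  constructor
  · exact hF'.prod.congr fun m => hG m
  · rw [← e, hF'.tsum_prod]
    exact tsum_congr hG

lemma swap_double (f : ℕ → ℕ → ℂ) (hf : Summable (fun p : ℕ × ℕ => f p.2 p.1)) :
    ∑' m : ℕ, ∑' j : ℕ, f m j = ∑' j : ℕ, ∑' m : ℕ, f m j := by
  have h : Summable (Function.uncurry f) := (Equiv.prodComm ℕ ℕ).summable_iff.1 hf
  exact h.tsum_comm.symm

lemma middle_eq (τ : ℂ) (hτ : 0 < τ.im) :
    ∑' p : ℤ × ℤ, (1 / ((p.1 : ℂ) + (2 * (p.2 : ℂ) + 1) * τ) ^ 2 -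
              1 / (((p.1 : ℂ) + 1 / 2) + (2 * (p.2 : ℂ) + 1) * τ) ^ 2) =
      (Real.pi : ℂ) ^ 2 * (-8 * Complex.I *
          ∑' n : ℕ, (2 * (n : ℂ) + 1) / Complex.sin (2 * (2 * (n : ℂ) + 1) * (Real.pi : ℂ) * τ)) := by
  obtain ⟨hG, hE⟩ := fubini_rows _ (rowG τ) (F_summable τ hτ) (fun m => row_tsum ((2 * (m : ℂ) + 1) * τ))
  rw [hE]
  have hneg : ∀ m : ℕ, rowG τ (-((m : ℤ) + 1)) = rowG τ (m : ℤ) := by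
    intro m
    unfold rowG
    rw [Int.cast_natCast]
    have e : (2 * ((-((m : ℤ) + 1) : ℤ) : ℂ) + 1) * τ = -((2 * (m : ℂ) + 1) * τ) := by
      push_cast
      ring
    rw [e, rowA_neg]
    congr 1
    rw [← rowA_neg, ← rowA_add_one]
    congr 1
    ring
  have hpos : ∀ m : ℕ, rowG τ (m : ℤ) =
      -8 * (Real.pi : ℂ) ^ 2 * ∑' j : ℕ, (2 * (j : ℂ) + 1) *
        (cexp (2 * Real.pi * I * τ) ^ (2 * m + 1)) ^ (2 * j + 1) := by
    intro m
    rw [rowG, Int.cast_natCast, row_diff]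
    · congr 1
      refine tsum_congr fun j => ?_
      rw [← Complex.exp_nat_mul (2 * Real.pi * I * τ)]
      congr 3
      push_cast
      ring
    · have : (2 * (m : ℂ) + 1) = ((2 * m + 1 : ℝ) : ℂ) := by push_cast; ring
      rw [this, im_ofReal_mul]
      positivity
  rw [tsum_of_nat_of_neg_add_one (hG.comp_injective Nat.cast_injective)
    (hG.comp_injective (i := fun m : ℕ => -((m : ℤ) + 1)) (fun a b h => by simpa using h))]
  simp only [hneg, hpos]
  rw [tsum_mul_left]
  have hd := double_summable _ (norm_q_lt τ hτ)
  rw [swap_double (fun m j : ℕ => (2 * (j : ℂ) + 1) *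
        (cexp (2 * Real.pi * I * τ) ^ (2 * m + 1)) ^ (2 * j + 1)) hd]
  simp only [geom_row τ hτ]
  rw [tsum_mul_left]
  ring

/-- `℘̃a(1/2, 2τ) = π⁻² Σ_{(n,m)∈ℤ²} (1/(n+(2m+1)τ)² − 1/((n+1/2)+(2m+1)τ)²)
= −8i Σ_{m odd, m ≥ 1} m/sin(2mπτ)`, the last series converging absolutely. -/
theorem wpt_half_two_tau_series (τ : ℂ) (hτ : 0 < τ.im) :
    Summable (fun n : ℕ =>
        ‖(2 * (n : ℂ) + 1) / Complex.sin (2 * (2 * (n : ℂ) + 1) * (Real.pi : ℂ) * τ)‖) ∧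
      wpt (1 / 2) (2 * τ) =
        (Real.pi : ℂ)⁻¹ ^ 2 *
          ∑' p : ℤ × ℤ,
            (1 / ((p.1 : ℂ) + (2 * (p.2 : ℂ) + 1) * τ) ^ 2 -
              1 / (((p.1 : ℂ) + 1 / 2) + (2 * (p.2 : ℂ) + 1) * τ) ^ 2) ∧
      wpt (1 / 2) (2 * τ) =
        -8 * Complex.I *
          ∑' n : ℕ, (2 * (n : ℂ) + 1) / Complex.sin (2 * (2 * (n : ℂ) + 1) * (Real.pi : ℂ) * τ) := by
  have hpi : (Real.pi : ℂ) ≠ 0 := by exact_mod_cast Real.pi_ne_zero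
  have hmid : wpt (1 / 2) (2 * τ) =
        (Real.pi : ℂ)⁻¹ ^ 2 *
          ∑' p : ℤ × ℤ,
            (1 / ((p.1 : ℂ) + (2 * (p.2 : ℂ) + 1) * τ) ^ 2 -
              1 / (((p.1 : ℂ) + 1 / 2) + (2 * (p.2 : ℂ) + 1) * τ) ^ 2) := by
    unfold wpt
    congr 1
    let e : ℤ ≃ ℤ := Equiv.subLeft (-1)
    rw [← (Equiv.prodCongr e e).tsum_eq (fun p : ℤ × ℤ =>
      (1 / ((p.1 : ℂ) + (2 * (p.2 : ℂ) + 1) * τ) ^ 2 -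
              1 / (((p.1 : ℂ) + 1 / 2) + (2 * (p.2 : ℂ) + 1) * τ) ^ 2))]
    refine tsum_congr fun p => ?_
    simp only [e, Equiv.prodCongr_apply, Prod.map_fst, Prod.map_snd, Equiv.subLeft_apply]
    push_cast
    congr 2 <;> ring
  refine ⟨(sin_series_summable τ hτ).norm, hmid, ?_⟩
  rw [hmid, middle_eq τ hτ, ← mul_assoc, ← mul_pow, inv_mul_cancel₀ hpi, one_pow, one_mul]
end

section
/- For every τ in the upper half-plane H, with q = e^{2πiτ}, one has the eta-quotient identity (1/256)·℘̃a(1/2, τ)² = q · Π_{k=1}^{∞} (1−q^{2k})^{16} / (1−q^{k})^{8} (this common value is the level-2 strong modular unit Δ₂(τ) = η(2τ)^{16} η(τ)^{−8}). -/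
open Complex

/-- q-Pochhammer -/
noncomputable def qpoch (q u : ℂ) : ℂ := ∏' n : ℕ, (1 - u * q ^ n)

lemma qpoch_summable {q : ℂ} (hq : ‖q‖ < 1) (u : ℂ) : Summable fun n : ℕ => ‖-(u * q ^ n)‖ := by
  simp only [norm_neg, norm_mul, norm_pow]
  exact (summable_geometric_of_lt_one (norm_nonneg _) hq).mul_left _

lemma qpoch_mult {q : ℂ} (hq : ‖q‖ < 1) (u : ℂ) : Multipliable fun n : ℕ => (1 - u * q ^ n) := by
  simpa [sub_eq_add_neg] using multipliable_one_add_of_summable (qpoch_summable hq u)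

lemma qpoch_succ {q : ℂ} (hq : ‖q‖ < 1) (u : ℂ) : qpoch q u = (1 - u) * qpoch q (q * u) := by
  unfold qpoch
  have h := qpoch_mult hq (q * u)
  have e : ∀ n : ℕ, 1 - q * u * q ^ n = 1 - u * q ^ (n + 1) := fun n => by ring
  simp only [e] at h ⊢
  rw [tprod_eq_zero_mul' (f := fun n => 1 - u * q ^ n) h]
  simp

lemma qpoch_ne_zero {q : ℂ} (hq : ‖q‖ < 1) {u : ℂ} (hu : ∀ n : ℕ, u * q ^ n ≠ 1) :
    qpoch q u ≠ 0 := by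
  unfold qpoch
  simp only [sub_eq_add_neg]
  refine tprod_one_add_ne_zero_of_summable (f := fun n => -(u * q ^ n)) ?_ (qpoch_summable hq u)
  intro n h
  apply hu n
  linear_combination -h

lemma qpoch_ne_zero' {q : ℂ} (hq : ‖q‖ < 1) {u : ℂ} (hu : ‖u‖ < 1) : qpoch q u ≠ 0 := by
  apply qpoch_ne_zero hq
  intro n h
  have : ‖u * q ^ n‖ < 1 := by
    rw [norm_mul, norm_pow]
    have : ‖q‖ ^ n ≤ 1 := pow_le_one₀ (norm_nonneg _) hq.le
    nlinarith [norm_nonneg u, norm_nonneg q]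
  rw [h] at this
  simp at this

lemma qpoch_diff {q : ℂ} (hq : ‖q‖ < 1) : Differentiable ℂ (qpoch q) := by
  intro u
  have hd : DifferentiableOn ℂ (qpoch q) (Metric.ball 0 (‖u‖ + 1)) := by
    have h := Summable.hasProdLocallyUniformlyOn_nat_one_add (f := fun (n : ℕ) (u : ℂ) => -(u * q ^ n))
      (K := Metric.ball (0 : ℂ) (‖u‖ + 1)) Metric.isOpen_ball
      (u := fun n => (‖u‖ + 1) * ‖q‖ ^ n)
      ((summable_geometric_of_lt_one (norm_nonneg _) hq).mul_left _)
      (Filter.Eventually.of_forall fun n x hx => by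
        simp only [norm_neg, norm_mul, norm_pow]
        have : ‖x‖ < ‖u‖ + 1 := by simpa using hx
        gcongr) (fun n => by fun_prop)
    have h2 := h.differentiableOn
      (.of_forall fun _ ↦ by simpa [Finset.prod_fn] using
      DifferentiableOn.finsetProd (fun _ _ ↦ by fun_prop)) Metric.isOpen_ball
    have e : qpoch q = fun x => ∏' i : ℕ, (1 + -(x * q ^ i)) := by
      ext x
      simp [qpoch, sub_eq_add_neg]
    rw [e]
    exact h2
  exact hd.differentiableAt (Metric.isOpen_ball.mem_nhds (by simp))

/-- theta -/
noncomputable def qth (q u : ℂ) : ℂ := qpoch q u * qpoch q (q / u)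

lemma qth_mul {q : ℂ} (hq : ‖q‖ < 1) (hq0 : q ≠ 0) {u : ℂ} (hu : u ≠ 0) :
    qth q (q * u) = - qth q u / u := by
  unfold qth
  rw [qpoch_succ hq u, show q / (q * u) = 1 / u by field_simp, qpoch_succ hq (1 / u)]
  rw [show q * (1 / u) = q / u by ring]
  field_simp
  ring

lemma qth_inv {q : ℂ} (hq : ‖q‖ < 1) (hq0 : q ≠ 0) {u : ℂ} (hu : u ≠ 0) :
    qth q (u⁻¹) = - qth q u / u := by
  rw [← qth_mul hq hq0 hu]
  unfold qth
  rw [show q / (q * u) = u⁻¹ by field_simp, show q / u⁻¹ = q * u by field_simp, mul_comm]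

lemma qpoch_final {q : ℂ} (hq : ‖q‖ < 1) :
    qpoch (q ^ 2) q * qpoch (q ^ 2) (q ^ 2) = qpoch q q := by
  have hq2 : ‖q ^ 2‖ < 1 := by
    rw [norm_pow]; exact pow_lt_one₀ (norm_nonneg _) hq (by norm_num)
  unfold qpoch
  rw [← tprod_even_mul_odd (f := fun n => 1 - q * q ^ n)]
  · congr 1
    · congr! 3 with n; ring
    · congr! 3 with n; ring
  · convert qpoch_mult hq2 q using 3 with n; ring
  · convert qpoch_mult hq2 (q ^ 2) using 3 with n; ring

lemma qpoch_pm {q : ℂ} (hq : ‖q‖ < 1) :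
    qpoch q q * qpoch q (-q) = qpoch (q ^ 2) (q ^ 2) := by
  unfold qpoch
  rw [← (qpoch_mult hq q).tprod_mul (qpoch_mult hq (-q))]
  congr! 2 with n; ring

lemma prod_final {q : ℂ} (hq : ‖q‖ < 1) :
    ∏' k : ℕ, (1 - q ^ (2 * (k + 1))) ^ 16 / (1 - q ^ (k + 1)) ^ 8
      = (qpoch (q ^ 2) (q ^ 2) / qpoch (q ^ 2) q) ^ 8 := by
  have hq2 : ‖q ^ 2‖ < 1 := by
    rw [norm_pow]; exact pow_lt_one₀ (norm_nonneg _) hq (by norm_num)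
  have h1 : ∀ k : ℕ, (1 - q ^ (2 * (k + 1))) ^ 16 / (1 - q ^ (k + 1)) ^ 8
      = ((1 - q ^ 2 * (q ^ 2) ^ k) * (1 - (-q) * q ^ k)) ^ 8 := by
    intro k
    have hne : (1 - q ^ (k + 1)) ≠ 0 := by
      intro h
      have h' : q ^ (k + 1) = 1 := by linear_combination -h
      have : ‖q ^ (k + 1)‖ < 1 := by
        rw [norm_pow]; exact pow_lt_one₀ (norm_nonneg _) hq (by norm_num)
      rw [h'] at this
      simp at this
    rw [div_eq_iff (pow_ne_zero _ hne), ← mul_pow]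
    rw [show 16 = 2 * 8 from rfl, pow_mul]
    congr 1
    ring
  simp only [h1]
  have hm := (qpoch_mult hq2 (q ^ 2)).mul (qpoch_mult hq (-q))
  rw [hm.tprod_pow 8, (qpoch_mult hq2 (q ^ 2)).tprod_mul (qpoch_mult hq (-q))]
  congr 1
  change qpoch (q ^ 2) (q ^ 2) * qpoch q (-q) = _
  have a := qpoch_final hq
  have b := qpoch_pm hq
  have n1 := qpoch_ne_zero' hq2 hq
  have n2 := qpoch_ne_zero' hq2 hq2
  rw [eq_div_iff n1]
  linear_combination b + qpoch q (-q) * a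

open Filter Topology in
lemma lim_shift (D : ℂ → ℂ) (c : ℂ) (h : ∀ w, D (w + c) = D w) (z : ℂ) :
    limUnder (𝓝[≠] (z + c)) D = limUnder (𝓝[≠] z) D := by
  have e : 𝓝[≠] (z + c) = Filter.map (fun w => w + c) (𝓝[≠] z) := by
    have := (Homeomorph.addRight c).isEmbedding.map_nhdsWithin_eq ({z}ᶜ) z
    simp only [Homeomorph.coe_addRight] at this
    rw [this]
    congr 1
    ext x
    simp [sub_eq_iff_eq_add, eq_sub_iff_add_eq]
  unfold limUnder
  rw [e, Filter.map_map]
  congr 2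
  ext w
  simp [h]

open Filter Topology in
lemma liouville_ab (D M : ℂ → ℂ) (T : ℂ) (hT : 0 < T.im) (b : ℝ) (hb : T.im / 2 < b)
    (h1 : ∀ w, D (w + Real.pi) = - D w) (h2 : ∀ w, D (w + T) = D w)
    (hM : DifferentiableOn ℂ M {w | |w.im| < b})
    (hDM : ∀ w : ℂ, |w.im| < b → sin w ≠ 0 → D w = M w / sin w ^ 2)
    (hM0 : M 0 = 0) (hM1 : HasDerivAt M 0 0) :
    ∀ w : ℂ, |w.im| < b → sin w ≠ 0 → D w = 0 := by
  set S : Set ℂ := {w | |w.im| < b} with hS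
  have hSo : IsOpen S := isOpen_lt (by fun_prop) (by fun_prop)
  set Dt : ℂ → ℂ := fun z => limUnder (𝓝[≠] z) D with hDt
  have hso : IsOpen {w : ℂ | sin w ≠ 0} := isOpen_ne_fun (by fun_prop) (by fun_prop)
  have good : ∀ w ∈ S, sin w ≠ 0 → DifferentiableAt ℂ D w := by
    intro w hw hs
    have e : D =ᶠ[𝓝 w] fun w => M w / sin w ^ 2 := by
      filter_upwards [hSo.mem_nhds hw, hso.mem_nhds hs] with z hz hz2
      exact hDM z hz hz2
    refine DifferentiableAt.congr_of_eventuallyEq ?_ e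
    have := hM.differentiableAt (hSo.mem_nhds hw)
    exact this.div (by fun_prop) (pow_ne_zero _ hs)
  have DtD : ∀ w ∈ S, sin w ≠ 0 → Dt w = D w := by
    intro w hw hs
    exact ((good w hw hs).continuousAt.tendsto.mono_left nhdsWithin_le_nhds).limUnder_eq
  have hnorm : ∀ (k : ℤ) z, ‖D (z + k * Real.pi)‖ = ‖D z‖ := by
    have : Function.Periodic (fun z => ‖D z‖) (Real.pi : ℂ) := by
      intro z
      simp [h1]
    exact fun k z => this.int_mul k z
  have p1 : ∀ z, Dt (z + 2 * Real.pi) = Dt z := by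
    intro z
    apply lim_shift
    intro w
    rw [two_mul, ← add_assoc, h1, h1, neg_neg]
  have p2 : ∀ z, Dt (z + T) = Dt z := fun z => lim_shift D T h2 z
  -- behaviour near zero
  have hsin : Tendsto (fun z : ℂ => sin z / z) (𝓝[≠] 0) (𝓝 1) := by
    have := (hasDerivAt_iff_tendsto_slope.1 (Complex.hasDerivAt_sin 0))
    simpa [slope_fun_def, div_eq_inv_mul] using this
  have hMz : Tendsto (fun z : ℂ => M z / z) (𝓝[≠] 0) (𝓝 0) := by
    have := (hasDerivAt_iff_tendsto_slope.1 hM1)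
    simpa [slope_fun_def, div_eq_inv_mul, hM0] using this
  have hb0 : 0 < b := by linarith
  have hS0 : (0 : ℂ) ∈ S := by simp [hS, hb0]
  have hsne : ∀ᶠ z : ℂ in 𝓝[≠] 0, sin z ≠ 0 := by
    have := hsin.eventually_ne (one_ne_zero)
    filter_upwards [this] with z hz h
    simp [h] at hz
  have hz0 : Tendsto (fun z : ℂ => z * D z) (𝓝[≠] 0) (𝓝 0) := by
    have : Tendsto (fun z : ℂ => (M z / z) / (sin z / z) ^ 2) (𝓝[≠] 0) (𝓝 (0 / 1 ^ 2)) :=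
      hMz.div (hsin.pow 2) (by norm_num)
    simp only [zero_div] at this
    refine this.congr' ?_
    filter_upwards [hsne, self_mem_nhdsWithin, nhdsWithin_le_nhds (hSo.mem_nhds hS0)] with z h1 h2 h3
    have h2' : z ≠ 0 := h2
    rw [hDM z h3 h1]
    field_simp
  have A : ∀ w ∈ S, DifferentiableAt ℂ Dt w := by
    intro w hw
    by_cases hs : sin w = 0
    · obtain ⟨k, hk⟩ := Complex.sin_eq_zero_iff.1 hs
      have hmap : Tendsto (fun z => z - w) (𝓝[≠] w) (𝓝[≠] 0) := by
        refine tendsto_nhdsWithin_iff.2 ⟨?_, ?_⟩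
        · have : Tendsto (fun z => z - w) (𝓝 w) (𝓝 (w - w)) := (continuous_id.sub continuous_const).tendsto w
          rw [sub_self] at this
          exact this.mono_left nhdsWithin_le_nhds
        · filter_upwards [self_mem_nhdsWithin] with z hz
          exact sub_ne_zero.2 hz
      have hev : ∀ᶠ z in 𝓝[≠] w, sin z ≠ 0 := by
        filter_upwards [hmap.eventually hsne] with z hz h
        apply hz
        rw [sin_sub, h, hs]; simp
      have hU : {z | z ∈ S ∧ sin z ≠ 0} ∈ 𝓝[≠] w := by
        filter_upwards [hev, nhdsWithin_le_nhds (hSo.mem_nhds hw)] with z h1 h2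
        exact ⟨h2, h1⟩
      have hd : DifferentiableOn ℂ D {z | z ∈ S ∧ sin z ≠ 0} := fun z hz =>
        (good z hz.1 hz.2).differentiableWithinAt
      have hzw : Tendsto (fun z : ℂ => (z - w) * D z) (𝓝[≠] w) (𝓝 0) := by
        rw [tendsto_zero_iff_norm_tendsto_zero] at hz0 ⊢
        refine (hz0.comp hmap).congr ?_
        intro z
        simp only [Function.comp, norm_mul]
        rw [← hnorm k (z - w), hk]
        simp
      have ho : (fun z => D z - D w) =o[𝓝[≠] w] fun z => (z - w)⁻¹ := by
        rw [Asymptotics.isLittleO_iff_tendsto']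
        · have h0 : Tendsto (fun z : ℂ => (z - w) * D w) (𝓝[≠] w) (𝓝 0) := by
            have := (hmap.mono_right nhdsWithin_le_nhds).mul_const (D w)
            simpa using this
          have := hzw.sub h0
          simp only [sub_zero] at this
          refine this.congr ?_
          intro z
          rw [div_inv_eq_mul]; ring
        · filter_upwards [self_mem_nhdsWithin] with z hz h
          exact absurd (inv_eq_zero.1 h) (sub_ne_zero.2 hz)
      have hup := differentiableOn_update_limUnder_insert_of_isLittleO hU hd ho
      have hUn : insert w {z | z ∈ S ∧ sin z ≠ 0} ∈ 𝓝 w := insert_mem_nhds_iff.2 hU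
      refine (hup.differentiableAt hUn).congr_of_eventuallyEq ?_
      filter_upwards [hUn] with z hz
      by_cases hzw : z = w
      · subst hzw; simp [hDt]
      · rw [Function.update_of_ne hzw]
        have := hz.resolve_left hzw
        exact DtD z this.1 this.2
    · refine (good w hw hs).congr_of_eventuallyEq ?_
      filter_upwards [hSo.mem_nhds hw, hso.mem_nhds hs] with z hz hz2
      exact DtD z hz hz2
  have p2k : ∀ (k : ℤ) z, Dt (z + k * T) = Dt z := by
    have : Function.Periodic Dt T := p2
    exact fun k z => this.int_mul k z
  have p1k : ∀ (k : ℤ) z, Dt (z + k * (2 * Real.pi)) = Dt z := by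
    have : Function.Periodic Dt (2 * Real.pi) := p1
    exact fun k z => this.int_mul k z
  have red : ∀ z : ℂ, |(z - (round (z.im / T.im) : ℤ) * T).im| ≤ T.im / 2 := by
    intro z
    have := abs_sub_round (z.im / T.im)
    have e : (z - (round (z.im / T.im) : ℤ) * T).im = (z.im / T.im - round (z.im / T.im)) * T.im := by
      simp
      field_simp
    rw [e, abs_mul, abs_of_pos hT]
    nlinarith
  have B : Differentiable ℂ Dt := by
    intro z
    set k := round (z.im / T.im)
    have h := A (z - k * T) (lt_of_le_of_lt (red z) hb)
    have e : Dt = fun x => Dt (x - k * T) := by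
      ext x
      rw [← p2k k (x - k * T)]; simp
    rw [e]
    exact DifferentiableAt.comp (f := fun x => x - k * T) z h (by fun_prop)
  have C : Bornology.IsBounded (Set.range Dt) := by
    have hc : IsCompact (Set.Icc (-Real.pi) (Real.pi) ×ℂ Set.Icc (-(T.im / 2)) (T.im / 2)) :=
      isCompact_Icc.reProdIm isCompact_Icc
    refine (hc.image B.continuous).isBounded.subset ?_
    rintro _ ⟨z, rfl⟩
    set z1 := z - (round (z.im / T.im) : ℤ) * T with hz1
    set z2 := z1 - (round (z1.re / (2 * Real.pi)) : ℤ) * (2 * Real.pi) with hz2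
    refine ⟨z2, ?_, ?_⟩
    · have hi : z2.im = z1.im := by simp [hz2]
      have hr : z2.re = (z1.re / (2 * Real.pi) - round (z1.re / (2 * Real.pi))) * (2 * Real.pi) := by
        have := Real.pi_pos
        simp only [hz2, sub_re, mul_re, intCast_re, intCast_im]
        simp
        field_simp
      have h3 := abs_sub_round (z1.re / (2 * Real.pi))
      have h4 := abs_le.1 (red z)
      have h5 := abs_le.1 h3
      have := Real.pi_pos
      rw [mem_reProdIm]
      refine ⟨⟨?_, ?_⟩, ⟨?_, ?_⟩⟩
      · rw [hr]; nlinarith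
      · rw [hr]; nlinarith
      · rw [hi]; exact h4.1
      · rw [hi]; exact h4.2
    · rw [← p1k (round (z1.re / (2 * Real.pi))) z2, hz2, sub_add_cancel,
        ← p2k (round (z.im / T.im)) z1, hz1, sub_add_cancel]
  intro w hw hs
  have hc := B.apply_eq_apply_of_bounded C w (w + Real.pi)
  rw [DtD w hw hs, DtD (w + Real.pi) (by simpa [hS] using hw) (by simpa [sin_add] using hs), h1] at hc
  have : (2 : ℂ) * D w = 0 := by linear_combination hc
  simpa using this

lemma norm_two_sin_ge (v : ℂ) : Real.exp |v.im| - Real.exp (-|v.im|) ≤ ‖2 * sin v‖ := by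
  have e : 2 * sin v = (exp (-v * I) - exp (v * I)) * I := by
    rw [Complex.sin]; ring
  have h1 : ‖exp (-v * I)‖ = Real.exp v.im := by rw [norm_exp]; simp
  have h2 : ‖exp (v * I)‖ = Real.exp (-v.im) := by rw [norm_exp]; simp
  rw [e, norm_mul, norm_I, mul_one]
  rcases le_total 0 v.im with h | h
  · rw [abs_of_nonneg h, ← h1, ← h2]
    exact norm_sub_norm_le _ _
  · rw [abs_of_nonpos h, neg_neg, ← h1, ← h2, norm_sub_rev]
    exact norm_sub_norm_le _ _

lemma norm_cos_le' (v : ℂ) : ‖cos v‖ ≤ Real.exp |v.im| := by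
  have h1 : ‖exp (-v * I)‖ ≤ Real.exp |v.im| := by
    rw [norm_exp]; simpa using le_abs_self v.im
  have h2 : ‖exp (v * I)‖ ≤ Real.exp |v.im| := by
    rw [norm_exp]; simpa using neg_le_abs v.im
  rw [Complex.cos, norm_div]
  have := norm_add_le (exp (v * I)) (exp (-v * I))
  simp only [Complex.norm_ofNat]
  linarith

lemma term_bound (v : ℂ) (c : ℝ) (hc : 0 < c) (hv : c ≤ |v.im|) :
    ‖cos v / sin v ^ 2‖ ≤ 4 / (1 - Real.exp (-2 * c)) ^ 2 * Real.exp (-|v.im|) := by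
  set t := |v.im| with ht
  have h1 := norm_two_sin_ge v
  rw [← ht, norm_mul, Complex.norm_ofNat] at h1
  have h2 := norm_cos_le' v
  rw [← ht] at h2
  have e1 : Real.exp (-t) = Real.exp t * Real.exp (-2 * t) := by rw [← Real.exp_add]; ring_nf
  have e2 : Real.exp (-2 * t) ≤ Real.exp (-2 * c) := Real.exp_le_exp.2 (by linarith)
  have e3 : Real.exp (-2 * c) < 1 := by
    rw [Real.exp_lt_one_iff]; linarith
  have hp := Real.exp_pos t
  have hp2 := Real.exp_pos (-t)
  have h3 : Real.exp t * (1 - Real.exp (-2 * c)) ≤ 2 * ‖sin v‖ := by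
    nlinarith
  have h4 : 0 < Real.exp t * (1 - Real.exp (-2 * c)) := mul_pos hp (by linarith)
  have h5 : 0 < ‖sin v‖ := by linarith
  have e4 : Real.exp (-t) * Real.exp t = 1 := by rw [← Real.exp_add]; simp
  rw [norm_div, norm_pow, div_mul_eq_mul_div, div_le_div_iff₀ (by positivity) (pow_pos (by linarith) 2)]
  have h6 := pow_le_pow_left₀ h4.le h3 2
  have h7 : 0 ≤ (1 - Real.exp (-2 * c)) ^ 2 := sq_nonneg _
  calc ‖cos v‖ * (1 - Real.exp (-2 * c)) ^ 2 ≤ Real.exp t * (1 - Real.exp (-2 * c)) ^ 2 := by gcongr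
    _ = Real.exp (-t) * (Real.exp t * (1 - Real.exp (-2 * c))) ^ 2 := by
      linear_combination (-Real.exp t * (1 - Real.exp (-2 * c)) ^ 2) * e4
    _ ≤ Real.exp (-t) * (2 * ‖sin v‖) ^ 2 := by gcongr
    _ = 4 * Real.exp (-t) * ‖sin v‖ ^ 2 := by ring

/-- the term -/
noncomputable def gt (v : ℂ) : ℂ := cos v / sin v ^ 2
/-- the full sum -/
noncomputable def Fs (T w : ℂ) : ℂ := ∑' m : ℤ, gt (w + m * T)
/-- the regular part -/
noncomputable def Hs (T w : ℂ) : ℂ := ∑' m : ℤ, if m = 0 then 0 else gt (w + m * T)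

lemma gt_neg (v : ℂ) : gt (-v) = gt v := by simp [gt]
lemma gt_pi (v : ℂ) : gt (v + Real.pi) = - gt v := by simp [gt, cos_add, sin_add, neg_div]

lemma Fs_pi (T w : ℂ) : Fs T (w + Real.pi) = - Fs T w := by
  unfold Fs
  rw [← tsum_neg]
  congr! 2 with m
  rw [← gt_pi]; congr 1; ring

lemma Fs_T (T w : ℂ) : Fs T (w + T) = Fs T w := by
  unfold Fs
  rw [← (Equiv.addRight (1 : ℤ)).tsum_eq (fun m : ℤ => gt (w + m * T))]
  congr! 2 with m
  congr 1; push_cast [Equiv.coe_addRight]; ring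

lemma Hs_neg (T w : ℂ) : Hs T (-w) = Hs T w := by
  unfold Hs
  rw [← (Equiv.neg ℤ).tsum_eq]
  congr! 2 with m
  simp only [Equiv.neg_apply, neg_eq_zero]
  split_ifs
  · rfl
  · rw [← gt_neg]; congr 1; push_cast; ring

lemma im_bound {T : ℂ} (hT : 0 < T.im) {w : ℂ} (hw : |w.im| < 3 / 4 * T.im) {m : ℤ} (hm : m ≠ 0) :
    T.im / 4 ≤ |(w + m * T).im| ∧ (m.natAbs : ℝ) * T.im - 3 / 4 * T.im ≤ |(w + m * T).im| := by
  have h1 : (1 : ℝ) ≤ |(m : ℝ)| := by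
    exact_mod_cast Int.one_le_abs hm
  have e : (w + m * T).im = m * T.im - (-w.im) := by simp; ring
  have h2 := abs_sub_abs_le_abs_sub ((m : ℝ) * T.im) (-w.im)
  rw [← e, abs_neg, abs_mul, abs_of_pos hT] at h2
  have h3 : ((m.natAbs : ℕ) : ℝ) = |(m : ℝ)| := by
    rw [Nat.cast_natAbs]; simp
  rw [h3]
  constructor <;> nlinarith

/-- majorant -/
noncomputable def maj (T : ℂ) (m : ℤ) : ℝ :=
  4 / (1 - Real.exp (-2 * (T.im / 4))) ^ 2 * Real.exp (3 / 4 * T.im) * Real.exp (-T.im) ^ m.natAbs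

lemma maj_bound {T : ℂ} (hT : 0 < T.im) {w : ℂ} (hw : |w.im| < 3 / 4 * T.im) {m : ℤ} (hm : m ≠ 0) :
    ‖gt (w + m * T)‖ ≤ maj T m := by
  obtain ⟨h1, h2⟩ := im_bound hT hw hm
  refine (term_bound _ _ (by positivity) h1).trans ?_
  unfold maj
  rw [mul_assoc, ← Real.exp_nat_mul, ← Real.exp_add]
  gcongr
  linarith

lemma maj_summable {T : ℂ} (hT : 0 < T.im) : Summable (maj T) := by
  unfold maj
  apply Summable.mul_left
  have : Summable fun n : ℕ => Real.exp (-T.im) ^ n :=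
    summable_geometric_of_lt_one (Real.exp_pos _).le (by rw [Real.exp_lt_one_iff]; linarith)
  apply Summable.of_nat_of_neg <;> simpa using this

lemma Fs_summable {T : ℂ} (hT : 0 < T.im) {w : ℂ} (hw : |w.im| < 3 / 4 * T.im) :
    Summable fun m : ℤ => gt (w + m * T) := by
  refine Summable.of_norm_bounded_eventually (maj_summable hT) ?_
  have : ∀ᶠ m : ℤ in Filter.cofinite, m ≠ 0 :=
    (Set.finite_singleton (0 : ℤ)).compl_mem_cofinite
  filter_upwards [this] with m hm
  exact maj_bound hT hw hm

lemma Fs_eq {T : ℂ} (hT : 0 < T.im) {w : ℂ} (hw : |w.im| < 3 / 4 * T.im) :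
    Fs T w = cos w / sin w ^ 2 + Hs T w := by
  unfold Fs Hs
  rw [(Fs_summable hT hw).tsum_eq_add_tsum_ite 0]
  simp [gt]

lemma Hs_diff {T : ℂ} (hT : 0 < T.im) :
    DifferentiableOn ℂ (Hs T) {w | |w.im| < 3 / 4 * T.im} := by
  refine differentiableOn_tsum_of_summable_norm (maj_summable hT) ?_
    (isOpen_lt (by fun_prop) (by fun_prop)) ?_
  · intro m w hw
    by_cases hm : m = 0
    · simp only [hm, if_true]; fun_prop
    · simp only [hm, if_false]
      have h1 := (im_bound hT hw hm).1
      have hs : sin (w + m * T) ≠ 0 := by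
        intro h
        have h2 := norm_two_sin_ge (w + m * T)
        rw [h] at h2
        have h3 : Real.exp |(w + m * T).im| ≤ Real.exp (-|(w + m * T).im|) := by
          simp only [mul_zero, norm_zero] at h2; linarith
        rw [Real.exp_le_exp] at h3
        linarith
      unfold gt
      apply DifferentiableAt.differentiableWithinAt
      exact DifferentiableAt.fun_div (by fun_prop) (by fun_prop) (pow_ne_zero _ hs)
  · intro m w hw
    split_ifs with hm
    · simp [maj]; positivity
    · exact maj_bound hT hw hm

lemma sin_pi_ne {z : ℂ} (hz : z.im ≠ 0) : sin (Real.pi * z) ≠ 0 := by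
  intro h0
  obtain ⟨k, hk⟩ := Complex.sin_eq_zero_iff.1 h0
  have := congrArg Complex.im hk
  simp at this
  exact hz this

lemma sum_inv_sq_upper {z : ℂ} (hz : 0 < z.im) :
    ∑' n : ℤ, 1 / (z + n) ^ 2 = (Real.pi : ℂ) ^ 2 / sin (Real.pi * z) ^ 2 := by
  have h := iteratedDerivWithin_cot_pi_mul_eq_mul_tsum_div_pow (k := 1) le_rfl (z := z) hz
  have hopen : IsOpen UpperHalfPlane.upperHalfPlaneSet := UpperHalfPlane.isOpen_upperHalfPlaneSet
  have hs : sin (Real.pi * z) ≠ 0 := sin_pi_ne hz.ne'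
  have hd : HasDerivAt (fun x : ℂ => (Real.pi : ℂ) * cot (Real.pi * x))
      (-((Real.pi : ℂ) ^ 2 / sin (Real.pi * z) ^ 2)) z := by
    have hl : HasDerivAt (fun x : ℂ => (Real.pi : ℂ) * x) (Real.pi : ℂ) z := by
      simpa using (hasDerivAt_id z).const_mul (Real.pi : ℂ)
    have h1 := ((hl.ccos.fun_div hl.csin hs).const_mul (Real.pi : ℂ))
    unfold Complex.cot
    refine h1.congr_deriv ?_
    have := sin_sq_add_cos_sq ((Real.pi : ℂ) * z)
    field_simp
    linear_combination -this
  rw [iteratedDerivWithin_one, derivWithin_of_isOpen hopen hz, hd.deriv] at h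
  simp only [pow_one, Nat.factorial_one, Nat.cast_one, mul_one, Nat.reduceAdd] at h
  linear_combination h

lemma sum_inv_sq {z : ℂ} (hz : z.im ≠ 0) :
    ∑' n : ℤ, 1 / (z + n) ^ 2 = (Real.pi : ℂ) ^ 2 / sin (Real.pi * z) ^ 2 := by
  rcases lt_or_gt_of_ne hz with h | h
  · have h' := sum_inv_sq_upper (z := -z) (by simpa using h)
    rw [mul_neg, sin_neg, neg_sq] at h'
    rw [← h', ← (Equiv.neg ℤ).tsum_eq]
    congr! 2 with n
    simp only [Equiv.neg_apply]
    push_cast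
    rw [show z + -(n : ℂ) = -(-z + n) by ring, neg_sq]
  · exact sum_inv_sq_upper h

lemma summable_inv_sq {z : ℂ} (hz : z.im ≠ 0) :
    Summable fun n : ℤ => 1 / (z + n) ^ 2 := by
  by_contra h
  have h1 := tsum_eq_zero_of_not_summable h
  rw [sum_inv_sq hz] at h1
  have := sin_pi_ne hz
  have := Real.pi_ne_zero
  simp_all

lemma indep_tau {τ : ℂ} (hτ : 0 < τ.im) : LinearIndependent ℝ ![(1 : ℂ), τ] := by
  rw [LinearIndependent.pair_iff]
  intro s t h
  have h1 := congrArg Complex.im h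
  have h2 := congrArg Complex.re h
  simp at h1 h2
  have ht : t = 0 := by
    rcases h1 with h | h
    · exact h
    · linarith
  simp [ht] at h2
  exact ⟨h2, ht⟩

lemma wpt_summable {τ : ℂ} (hτ : 0 < τ.im) : Summable fun p : ℤ × ℤ =>
      (1 / ((1 / 2 : ℂ) + ((p.1 : ℂ) + 1 / 2) + ((p.2 : ℂ) + 1 / 2) * τ) ^ 2 -
        1 / (((p.1 : ℂ) + 1 / 2) + ((p.2 : ℂ) + 1 / 2) * τ) ^ 2) := by
  let L : PeriodPair := ⟨1, τ, indep_tau hτ⟩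
  have h0 := (L.hasSum_weierstrassP (-(1 + τ / 2))).summable
  have h1 := (L.hasSum_weierstrassP (-(1 / 2 + τ / 2))).summable
  have h2 := (h0.sub h1)
  rw [← L.latticeEquivProd.symm.toEquiv.summable_iff] at h2
  refine h2.congr ?_
  intro p
  simp only [Function.comp]
  have e := L.latticeEquiv_symm_apply p
  change _ = _ at e
  simp only [LinearEquiv.coe_toEquiv, e]
  rw [show (-(1 + τ / 2) - (p.1 * L.ω₁ + p.2 * L.ω₂)) ^ 2 =
    ((1 / 2 : ℂ) + ((p.1 : ℂ) + 1 / 2) + ((p.2 : ℂ) + 1 / 2) * τ) ^ 2 by simp only [L]; ring]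
  rw [show (-(1 / 2 + τ / 2) - (p.1 * L.ω₁ + p.2 * L.ω₂)) ^ 2 =
    (((p.1 : ℂ) + 1 / 2) + ((p.2 : ℂ) + 1 / 2) * τ) ^ 2 by simp only [L]; ring]
  ring

lemma wpt_eq {τ : ℂ} (hτ : 0 < τ.im) :
    wpt (1 / 2) τ = 4 * Fs (2 * Real.pi * τ) (Real.pi * τ) := by
  unfold wpt
  have hs := wpt_summable hτ
  rw [← (Equiv.prodComm ℤ ℤ).summable_iff] at hs
  simp only [Function.comp_def] at hs
  rw [← (Equiv.prodComm ℤ ℤ).tsum_eq]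
  rw [hs.tsum_prod]
  unfold Fs
  rw [← tsum_mul_left, ← tsum_mul_left]
  congr! 2 with m
  simp only [Equiv.prodComm_apply, Prod.swap]
  have hmi : ((m : ℝ) + 1 / 2) ≠ 0 := by
    intro h
    have h2 : (2 * m + 1 : ℝ) = 0 := by linarith
    have : (2 * m + 1 : ℤ) = 0 := by exact_mod_cast h2
    omega
  set a : ℂ := ((m : ℂ) + 1 / 2) * τ with ha
  have ha0 : a.im ≠ 0 := by
    have : a.im = ((m : ℝ) + 1 / 2) * τ.im := by
      simp [ha]
    rw [this]
    exact mul_ne_zero hmi hτ.ne'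
  have i1 : (1 + a).im ≠ 0 := by simpa using ha0
  have i2 : (1 / 2 + a).im ≠ 0 := by simpa using ha0
  have e1 : ∀ n : ℤ, (1 / (1 / 2 + ((n : ℂ) + 1 / 2) + a) ^ 2 - 1 / (((n : ℂ) + 1 / 2) + a) ^ 2)
      = 1 / ((1 + a) + n) ^ 2 - 1 / ((1 / 2 + a) + n) ^ 2 := by
    intro n
    congr 3 <;> ring
  simp only [e1]
  rw [(summable_inv_sq i1).tsum_sub (summable_inv_sq i2), sum_inv_sq i1, sum_inv_sq i2]
  have n1 := sin_pi_ne i1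
  have n2 := sin_pi_ne i2
  have s1 : sin (Real.pi * (1 + a)) = - sin (Real.pi * a) := by
    rw [mul_add, mul_one, sin_add]; simp
  have s2 : sin (Real.pi * (1 / 2 + a)) = cos (Real.pi * a) := by
    rw [mul_add, show (Real.pi : ℂ) * (1 / 2) = Real.pi / 2 by ring, sin_add]; simp
  rw [s1] at n1 ⊢
  rw [s2] at n2 ⊢
  have n1' : sin (Real.pi * a) ≠ 0 := by simpa using n1
  have e2 : (Real.pi : ℂ) * τ + m * (2 * Real.pi * τ) = 2 * (Real.pi * a) := by
    rw [ha]; ring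
  rw [e2, gt, sin_two_mul, cos_two_mul]
  have hpi : (Real.pi : ℂ) ≠ 0 := by exact_mod_cast Real.pi_ne_zero
  have hsc := sin_sq_add_cos_sq ((Real.pi : ℂ) * a)
  field_simp
  linear_combination (-4) * hsc

/-- the theta quotient, without normalising constant -/
noncomputable def Rq (T w : ℂ) : ℂ :=
  exp (w * I) * qth (exp (T * I)) (-exp (2 * w * I)) / qth (exp (2 * T * I)) (exp (2 * w * I)) ^ 2

/-- its regularisation -/
noncomputable def Rn (T w : ℂ) : ℂ :=
  -(exp (w * I) * qth (exp (T * I)) (-exp (2 * w * I)) * exp (-(2 * w * I))) /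
    (4 * (qpoch (exp (2 * T * I)) (exp (2 * T * I) * exp (2 * w * I)) *
      qpoch (exp (2 * T * I)) (exp (2 * T * I) * exp (-(2 * w * I)))) ^ 2)

lemma norm_exp_I_lt {T : ℂ} (hT : 0 < T.im) : ‖exp (T * I)‖ < 1 := by
  rw [norm_exp, Real.exp_lt_one_iff]; simpa using hT

lemma Rq_pi (T w : ℂ) : Rq T (w + Real.pi) = - Rq T w := by
  unfold Rq
  rw [show 2 * (w + Real.pi) * I = 2 * w * I + 2 * Real.pi * I by ring, exp_periodic,
    add_mul, exp_add, exp_pi_mul_I]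
  ring

lemma Rq_T {T : ℂ} (hT : 0 < T.im) (w : ℂ) : Rq T (w + T) = Rq T w := by
  have h1 := norm_exp_I_lt hT
  have h2 : ‖exp (2 * T * I)‖ < 1 := norm_exp_I_lt (by simpa using hT)
  unfold Rq
  have e2 : exp (2 * T * I) = exp (T * I) * exp (T * I) := by rw [← exp_add]; ring_nf
  have e3 : exp (2 * (w + T) * I) = exp (2 * T * I) * exp (2 * w * I) := by
    rw [← exp_add]; ring_nf
  have e4 : exp ((w + T) * I) = exp (T * I) * exp (w * I) := by rw [← exp_add]; ring_nf
  have hu := exp_ne_zero (2 * w * I)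
  have hq := exp_ne_zero (T * I)
  rw [e3, qth_mul h2 (exp_ne_zero _) hu, e4,
    show -(exp (2 * T * I) * exp (2 * w * I)) = exp (T * I) * (exp (T * I) * -exp (2 * w * I)) by
      rw [e2]; ring,
    qth_mul h1 hq (mul_ne_zero hq (neg_ne_zero.2 hu)), qth_mul h1 hq (neg_ne_zero.2 hu)]
  by_cases h0 : qth (exp (2 * T * I)) (exp (2 * w * I)) = 0
  · simp [h0]
  · field_simp

lemma Rn_neg {T : ℂ} (hT : 0 < T.im) (w : ℂ) : Rn T (-w) = Rn T w := by
  have h1 := norm_exp_I_lt hT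
  unfold Rn
  have hu := exp_ne_zero (2 * w * I)
  rw [show 2 * -w * I = -(2 * w * I) by ring, neg_neg]
  have e : -exp (-(2 * w * I)) = (-exp (2 * w * I))⁻¹ := by rw [exp_neg, inv_neg]
  rw [e, qth_inv h1 (exp_ne_zero _) (neg_ne_zero.2 hu)]
  have e2 : exp (-w * I) = exp (w * I) * exp (-(2 * w * I)) := by rw [← exp_add]; ring_nf
  rw [e2]
  have hh : exp (-(2 * w * I)) * exp (2 * w * I) = 1 := by rw [← exp_add]; simp
  congr 1
  · field_simp
  · ring

lemma Rq_eq {T : ℂ} (hT : 0 < T.im) (w : ℂ) (hs : sin w ≠ 0) : Rq T w = Rn T w / sin w ^ 2 := by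
  have h2 : ‖exp (2 * T * I)‖ < 1 := norm_exp_I_lt (by simpa using hT)
  unfold Rq Rn
  set A := qpoch (exp (2 * T * I)) (exp (2 * T * I) * exp (2 * w * I))
  set B := qpoch (exp (2 * T * I)) (exp (2 * T * I) * exp (-(2 * w * I)))
  have ht : qth (exp (2 * T * I)) (exp (2 * w * I)) = (1 - exp (2 * w * I)) * (A * B) := by
    unfold qth
    rw [qpoch_succ h2 (exp (2 * w * I)), div_eq_mul_inv, ← exp_neg]
    ring
  have e1 : (1 - exp (2 * w * I)) ^ 2 = -4 * exp (2 * w * I) * sin w ^ 2 := by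
    have : 1 - exp (2 * w * I) = -2 * I * exp (w * I) * sin w := by
      rw [Complex.sin, show 2 * w * I = w * I + w * I by ring, exp_add]
      have : exp (w * I) * exp (-w * I) = 1 := by rw [← exp_add]; simp
      have hI := I_mul_I
      linear_combination (-this) + (exp (w * I) * (exp (-w * I) - exp (w * I))) * hI
    rw [this, show 2 * w * I = w * I + w * I by ring, exp_add]
    linear_combination (4 * exp (w * I) ^ 2 * sin w ^ 2) * I_mul_I
  rw [ht, mul_pow, e1, exp_neg]
  have hu := exp_ne_zero (2 * w * I)
  by_cases hab : A * B = 0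
  · simp [hab]
  · field_simp

lemma Rn_diff {T : ℂ} (hT : 0 < T.im) :
    DifferentiableOn ℂ (Rn T) {w | |w.im| < 3 / 4 * T.im} := by
  have h1 := norm_exp_I_lt hT
  have h2 : ‖exp (2 * T * I)‖ < 1 := norm_exp_I_lt (by simpa using hT)
  have d1 := qpoch_diff h1
  have d2 := qpoch_diff h2
  intro w hw
  have hw' := abs_lt.1 (show |w.im| < 3 / 4 * T.im from hw)
  have n1 : qpoch (exp (2 * T * I)) (exp (2 * T * I) * exp (2 * w * I)) ≠ 0 := by
    apply qpoch_ne_zero' h2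
    rw [← exp_add, norm_exp, Real.exp_lt_one_iff]
    simp
    linarith
  have n2 : qpoch (exp (2 * T * I)) (exp (2 * T * I) * exp (-(2 * w * I))) ≠ 0 := by
    apply qpoch_ne_zero' h2
    rw [← exp_add, norm_exp, Real.exp_lt_one_iff]
    simp
    linarith
  apply DifferentiableAt.differentiableWithinAt
  unfold Rn qth
  refine DifferentiableAt.fun_div ?_ ?_ ?_
  · have hne : ∀ w : ℂ, -exp (2 * w * I) ≠ 0 := fun w => neg_ne_zero.2 (exp_ne_zero _)
    have : DifferentiableAt ℂ (fun w : ℂ => exp (T * I) / -exp (2 * w * I)) w :=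
      DifferentiableAt.fun_div (by fun_prop) (by fun_prop) (hne w)
    have := (d1 (exp (T * I) / -exp (2 * w * I))).fun_comp' w this
    fun_prop
  · fun_prop
  · exact mul_ne_zero (by norm_num) (pow_ne_zero _ (mul_ne_zero n1 n2))

lemma main_Fs {T : ℂ} (hT : 0 < T.im) :
    Fs T (T / 2) = -4 * exp (T / 2 * I) *
      (qpoch (exp (2 * T * I)) (exp (2 * T * I)) / qpoch (exp (2 * T * I)) (exp (T * I))) ^ 4 := by
  have h1 := norm_exp_I_lt hT
  have h2 : ‖exp (2 * T * I)‖ < 1 := norm_exp_I_lt (by simpa using hT)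
  set q := exp (T * I) with hq
  set Q := exp (2 * T * I) with hQ
  have hQq : Q = q * q := by rw [hQ, hq, ← exp_add]; ring_nf
  have nA : qpoch Q Q ≠ 0 := qpoch_ne_zero' h2 h2
  have hth : qth q (-1) = 2 * qpoch q (-q) ^ 2 := by
    unfold qth
    rw [qpoch_succ h1 (-1)]
    rw [show q / -1 = -q by ring, show q * -1 = -q by ring]
    ring
  have nth : qth q (-1) ≠ 0 := by
    rw [hth]
    exact mul_ne_zero two_ne_zero (pow_ne_zero _ (qpoch_ne_zero' h1 (by simpa using h1)))
  have hR0 : Rn T 0 = -qth q (-1) / (4 * qpoch Q Q ^ 4) := by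
    unfold Rn
    simp only [mul_zero, zero_mul, exp_zero, neg_zero, mul_one, one_mul]
    rw [← hq, ← hQ]; ring
  set C := -4 * qpoch Q Q ^ 4 / qth q (-1) with hC
  have hCR : C * Rn T 0 = 1 := by
    rw [hR0, hC]; field_simp
  set M : ℂ → ℂ := fun w => cos w + sin w ^ 2 * Hs T w - C * Rn T w with hM
  have hMd : DifferentiableOn ℂ M {w | |w.im| < 3 / 4 * T.im} := by
    have a := Hs_diff hT
    have b := Rn_diff hT
    have c1 : Differentiable ℂ (fun w : ℂ => cos w) := by fun_prop
    have c2 : Differentiable ℂ (fun w : ℂ => sin w ^ 2) := by fun_prop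
    exact (c1.differentiableOn.add (c2.differentiableOn.mul a)).sub (b.const_mul C)
  have hMneg : ∀ w, M (-w) = M w := by
    intro w
    simp only [hM, Hs_neg, Rn_neg hT, cos_neg, sin_neg, neg_sq]
  have hM0 : M 0 = 0 := by
    simp [hM, hCR]
  have hSo : IsOpen {w : ℂ | |w.im| < 3 / 4 * T.im} := isOpen_lt (by fun_prop) (by fun_prop)
  have hM1 : HasDerivAt M 0 0 := by
    have hd : HasDerivAt M (deriv M 0) 0 :=
      (hMd.differentiableAt (hSo.mem_nhds (by simpa using hT))).hasDerivAt
    have h3 : deriv (fun w => M (-w)) 0 = - deriv M (-0) := deriv_comp_neg M 0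
    rw [funext hMneg, neg_zero] at h3
    have h4 : deriv M 0 = 0 := by
      have : (2 : ℂ) * deriv M 0 = 0 := by linear_combination h3
      simpa using this
    rwa [h4] at hd
  have key := liouville_ab (fun w => Fs T w - C * Rq T w) M T hT (3 / 4 * T.im) (by linarith)
    (fun w => by simp only [Fs_pi, Rq_pi]; ring)
    (fun w => by simp only [Fs_T, Rq_T hT]) hMd
    (fun w hw hs => by
      simp only [hM]
      rw [Fs_eq hT hw, Rq_eq hT w hs]
      field_simp) hM0 hM1
  have him : (T / 2).im = T.im / 2 := by simp
  have hsn : sin (T / 2) ≠ 0 := by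
    intro h0
    obtain ⟨k, hk⟩ := Complex.sin_eq_zero_iff.1 h0
    have := congrArg Complex.im hk
    rw [him] at this
    simp at this
    linarith
  have hk := key (T / 2) (by rw [him, abs_of_pos (by linarith)]; linarith) hsn
  have hF : Fs T (T / 2) = C * Rq T (T / 2) := by linear_combination hk
  rw [hF]
  unfold Rq
  rw [show 2 * (T / 2) * I = T * I by ring, ← hq, ← hQ]
  have e1 : qth q (-q) = qth q (-1) := by
    have := qth_mul h1 (exp_ne_zero _) (u := -1) (by norm_num)
    rw [show q * -1 = -q by ring] at this
    rw [this]; ring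
  have e2 : qth Q q = qpoch Q q ^ 2 := by
    unfold qth
    rw [show Q / q = q by rw [hQq]; field_simp]
    ring
  rw [e1, e2, hC]
  have nB : qpoch Q q ≠ 0 := qpoch_ne_zero' h2 h1
  field_simp

theorem delta2_eta_quotient (τ : ℂ) (hτ : 0 < τ.im) :
    1 / 256 * wpt (1 / 2) τ ^ 2 =
      Complex.exp (2 * Real.pi * Complex.I * τ) *
        ∏' k : ℕ,
          (1 - Complex.exp (2 * Real.pi * Complex.I * τ) ^ (2 * (k + 1))) ^ 16 /
            (1 - Complex.exp (2 * Real.pi * Complex.I * τ) ^ (k + 1)) ^ 8 := by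
  have hT : 0 < (2 * Real.pi * τ : ℂ).im := by
    have : (2 * Real.pi * τ : ℂ).im = 2 * Real.pi * τ.im := by simp
    rw [this]; have := Real.pi_pos; positivity
  have h := main_Fs hT
  rw [show (2 * Real.pi * τ : ℂ) / 2 = Real.pi * τ by ring] at h
  have e1 : (2 * Real.pi * Complex.I * τ : ℂ) = 2 * Real.pi * τ * I := by ring
  have hn := norm_exp_I_lt hT
  rw [e1, prod_final hn, wpt_eq hτ, h]
  have e2 : exp (2 * (2 * Real.pi * τ) * I) = exp (2 * Real.pi * τ * I) ^ 2 := by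
    rw [← exp_nat_mul]; congr 1; push_cast; ring
  have e3 : exp (2 * Real.pi * τ * I) = exp (Real.pi * τ * I) ^ 2 := by
    rw [← exp_nat_mul]; congr 1; push_cast; ring
  rw [e2]
  generalize qpoch (exp (2 * Real.pi * τ * I) ^ 2) (exp (2 * Real.pi * τ * I) ^ 2) /
    qpoch (exp (2 * Real.pi * τ * I) ^ 2) (exp (2 * Real.pi * τ * I)) = X
  rw [e3]
  ring
end

section
/- For every τ in the upper half-plane H, with q = e^{2πiτ}, one has the eta-quotient identity −(1/16)·℘̃a(1/2, 2τ) = q · Π_{n=1}^{∞} (1−q^{4n})^{8} / (1−q^{2n})^{4} (this common value is the level-4 strong modular unit Δ₄(τ) = η(4τ)^{8} η(2τ)^{−4}). -/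
open Complex

open Filter Topology


noncomputable def pA (s : ℂ) (n : ℕ) : ℂ := ∏ i ∈ Finset.range n, (1 - s ^ (2 * i + 2))
noncomputable def pB (s : ℂ) (n : ℕ) : ℂ := ∏ i ∈ Finset.range n, (1 - s ^ (2 * i + 1))
noncomputable def pU (s : ℂ) (n : ℕ) : ℂ := pB s n / pA s n
noncomputable def pT (s : ℂ) (m : ℕ) : ℂ :=
  s ^ m * (1 + s ^ (2 * m + 1)) / (1 - s ^ (2 * m + 1)) ^ 2

lemma pU_succ (s : ℂ) (n : ℕ) :
    pU s (n + 1) = pU s n * ((1 - s ^ (2 * n + 1)) / (1 - s ^ (2 * n + 2))) := by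
  simp only [pU, pA, pB, Finset.prod_range_succ]
  rw [mul_div_mul_comm]

lemma wz_step (s e y u v : ℂ) (hs : s ≠ 0) (hy : y ≠ 0)
    (h1 : 1 - s * y ^ 2 ≠ 0) (h2 : 1 - e * s * y ^ 2 ≠ 0)
    (h3' : 1 - e * s ^ 3 * y ^ 4 ≠ 0)
    (h4 : 1 - e * s ≠ 0) (h5 : 1 - e * s ^ 2 * y ^ 2 ≠ 0) :
    e * s * y ^ 2 * (1 - s ^ 3 * e ^ 2 * y ^ 4) /
        ((1 - e * s * y ^ 2) ^ 3 * (1 - e * s ^ 2 * y ^ 2)) *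
        (y - 1 / y) * (u * (v * ((1 - e) / (1 - e * s)))) +
      (((1 - e * s ^ 2 * y ^ 2) / (1 - e * s * y ^ 2)) ^ 2 *
        (y * (1 + s * y ^ 2) / (1 - s * y ^ 2) ^ 2 *
        (u * ((1 - s ^ 2 * e * y ^ 4) / (1 - e * s ^ 3 * y ^ 4))) *
        (v * ((1 - e) / (1 - e * s)))) -
       (y * (1 + s * y ^ 2) / (1 - s * y ^ 2) ^ 2) * u * v) =
    e * s * y ^ 2 * (1 - s ^ 3 * e ^ 2 * y ^ 4) /
        ((1 - e * s * y ^ 2) ^ 3 * (1 - e * s ^ 2 * y ^ 2)) *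
        (s * y - 1 / (s * y)) *
        (u * ((1 - s ^ 2 * e * y ^ 4) / (1 - e * s ^ 3 * y ^ 4)) * v) := by
  field_simp
  ring

section elem
variable {s : ℂ}

lemma wz_partial (hs : s ≠ 0) (h : ∀ k : ℕ, 1 - s ^ (k + 1) ≠ 0) (N M k : ℕ) (hN : N = M + k)
    (hN0 : 0 < N) :
    ∑ m ∈ Finset.range M, (((1 - s ^ (2 * N + 1)) / (1 - s ^ (2 * N))) ^ 2 *
        (pT s m * pU s (N + m + 1) * pU s (N - m)) - pT s m * pU s (N + m) * pU s (N - 1 - m)) =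
      s ^ (2 * N) * (1 - s ^ (4 * N + 1)) / ((1 - s ^ (2 * N)) ^ 3 * (1 - s ^ (2 * N + 1))) *
        (s ^ M - 1 / s ^ M) * (pU s (N + M) * pU s k) := by
  induction M generalizing k with
  | zero => simp
  | succ M ih =>
    rw [Finset.sum_range_succ, ih (k + 1) (by omega)]
    have e1 : N - M = k + 1 := by omega
    have e2 : N - 1 - M = k := by omega
    rw [e1, e2, ← add_assoc, pU_succ s k, pU_succ s (N + M)]
    have := wz_step s (s ^ (2 * k + 1)) (s ^ M) (pU s (N + M)) (pU s k) hs (pow_ne_zero _ hs)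
      (by convert h (2 * M) using 2; ring)
      (by convert h (2 * k + 2 * M + 1) using 2; ring)
      (by convert h (4 * M + 2 * k + 3) using 2; ring)
      (by convert h (2 * k + 1) using 2; ring)
      (by convert h (2 * k + 2 * M + 2) using 2; ring)
    subst hN
    convert this using 1
    · simp only [pT]
      ring_nf
    · ring_nf

lemma wz_last (s x a : ℂ) (h1 : 1 - x ^ 2 ≠ 0) (h2 : 1 - x ^ 2 * s ≠ 0)
    (h3 : 1 - x ^ 4 * s ^ 2 ≠ 0) :
    x ^ 2 * (1 - x ^ 4 * s) / ((1 - x ^ 2) ^ 3 * (1 - x ^ 2 * s)) * (x - 1 / x) * (a * 1) +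
      ((1 - x ^ 2 * s) / (1 - x ^ 2)) ^ 2 * (x * (1 + x ^ 2 * s) / (1 - x ^ 2 * s) ^ 2 *
        (a * ((1 - x ^ 4 * s) / (1 - x ^ 4 * s ^ 2))) * 1) = 0 := by
  have h4 : 1 + x ^ 2 * s ≠ 0 := by
    intro h
    apply h3
    linear_combination (1 - x ^ 2 * s) * h
  have h5 : 1 - x ^ 4 * s ^ 2 = (1 - x ^ 2 * s) * (1 + x ^ 2 * s) := by ring
  rw [h5]
  field_simp
  ring

lemma finite_id (hs : s ≠ 0) (h : ∀ k : ℕ, 1 - s ^ (k + 1) ≠ 0) (n : ℕ) :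
    ∑ m ∈ Finset.range (n + 1), pT s m * pU s (n + 1 + m) * pU s (n - m) =
      pA s n ^ 2 / pB s (n + 1) ^ 2 := by
  induction n with
  | zero =>
    have h1 := h 0
    have h2 := h 1
    simp [pT, pU, pA, pB] at *
    field_simp
    ring
  | succ n ih =>
    have key := wz_partial hs h (n + 1) (n + 1) 0 (by omega) (by omega)
    rw [Finset.sum_sub_distrib, ← Finset.mul_sum] at key
    have e0 : ∀ m, n + 1 - 1 - m = n - m := fun m => by omega
    simp only [e0] at key
    rw [ih] at key
    rw [Finset.sum_range_succ]
    have e1 : ∀ m, n + 1 + 1 + m = n + 1 + m + 1 := fun m => by omega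
    simp only [e1]
    rw [sub_eq_iff_eq_add] at key
    have h1 : 1 - s ^ (2 * (n + 1)) ≠ 0 := h (2 * n + 1)
    have h2 : 1 - s ^ (2 * (n + 1) + 1) ≠ 0 := h (2 * n + 2)
    have h3 : ((1 - s ^ (2 * (n + 1) + 1)) / (1 - s ^ (2 * (n + 1)))) ^ 2 ≠ 0 :=
      pow_ne_zero _ (div_ne_zero h2 h1)
    apply mul_left_cancel₀ h3
    rw [mul_add, key]
    have hz := wz_last s (s ^ (n + 1)) (pU s (n + 1 + (n + 1)))
      (by convert h1 using 2; ring) (by convert h2 using 2; ring)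
      (by convert h (4 * n + 5) using 2; ring)
    have hu0 : pU s (n + 1 - (n + 1)) = 1 := by simp [pU, pA, pB]
    have hu0' : pU s 0 = 1 := by simp [pU, pA, pB]
    have hB : pB s (n + 1 + 1) = pB s (n + 1) * (1 - s ^ (2 * (n + 1) + 1)) := by
      rw [pB, Finset.prod_range_succ]; rfl
    have hA : pA s (n + 1) = pA s n * (1 - s ^ (2 * (n + 1))) := by
      rw [pA, Finset.prod_range_succ]; rfl
    have hb : ((1 - s ^ (2 * (n + 1) + 1)) / (1 - s ^ (2 * (n + 1)))) ^ 2 *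
        (pA s (n + 1) ^ 2 / pB s (n + 1 + 1) ^ 2) = pA s n ^ 2 / pB s (n + 1) ^ 2 := by
      rw [hA, hB]
      by_cases h0 : pB s (n + 1) = 0
      · simp [h0]
      · field_simp
    rw [hb, hu0, hu0', pU_succ s (n + 1 + (n + 1))]
    have p2 : (s ^ (n + 1)) ^ 2 = s ^ (2 * (n + 1)) := by ring
    have p2s : s ^ (2 * (n + 1)) * s = s ^ (2 * (n + 1) + 1) := by ring
    have p4s : (s ^ (n + 1)) ^ 4 * s = s ^ (4 * (n + 1) + 1) := by ring
    have p4s' : s ^ (2 * (n + 1 + (n + 1)) + 1) = s ^ (4 * (n + 1) + 1) := by ring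
    have p4t : (s ^ (n + 1)) ^ 4 * s ^ 2 = s ^ (2 * (n + 1 + (n + 1)) + 2) := by ring
    rw [p2, p2s, p4s, p4t] at hz
    rw [p4s', pT]
    linear_combination hz


lemma one_sub_ne (hn : ‖s‖ < 1) (k : ℕ) : 1 - s ^ (k + 1) ≠ 0 := by
  intro h
  have h1 : s ^ (k + 1) = 1 := (sub_eq_zero.mp h).symm
  have : ‖s‖ ^ (k + 1) = 1 := by rw [← norm_pow, h1, norm_one]
  have h2 := pow_lt_one₀ (norm_nonneg s) hn (Nat.succ_ne_zero k)
  simp only [Nat.succ_eq_add_one] at h2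
  linarith

lemma sumA (hn : ‖s‖ < 1) : Summable fun i : ℕ => ‖-s ^ (2 * i + 2)‖ := by
  have : Summable fun i : ℕ => ‖s‖ ^ i := summable_geometric_of_lt_one (norm_nonneg _) hn
  simpa [Function.comp_def] using! this.comp_injective (i := fun i : ℕ => 2 * i + 2) (fun a b h => by simpa using h)

lemma sumB (hn : ‖s‖ < 1) : Summable fun i : ℕ => ‖-s ^ (2 * i + 1)‖ := by
  have : Summable fun i : ℕ => ‖s‖ ^ i := summable_geometric_of_lt_one (norm_nonneg _) hn
  simpa [Function.comp_def] using! this.comp_injective (i := fun i : ℕ => 2 * i + 1) (fun a b h => by simpa using h)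

lemma exists_limits (hn : ‖s‖ < 1) : ∃ A B : ℂ, A ≠ 0 ∧ B ≠ 0 ∧ HasProd (fun i : ℕ => 1 - s ^ (2 * i + 2)) A ∧
    HasProd (fun i : ℕ => 1 - s ^ (2 * i + 1)) B := by
  refine ⟨_, _, tprod_one_add_ne_zero_of_summable (f := fun i : ℕ => -s ^ (2 * i + 2)) ?_ (sumA hn),
    tprod_one_add_ne_zero_of_summable (f := fun i : ℕ => -s ^ (2 * i + 1)) ?_ (sumB hn), ?_, ?_⟩
  · intro i; rw [← sub_eq_add_neg]; exact one_sub_ne hn (2 * i + 1)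
  · intro i; rw [← sub_eq_add_neg]; exact one_sub_ne hn (2 * i)
  · simpa [sub_eq_add_neg] using (multipliable_one_add_of_summable (sumA hn)).hasProd
  · simpa [sub_eq_add_neg] using (multipliable_one_add_of_summable (sumB hn)).hasProd

lemma summable_pT (hn : ‖s‖ < 1) : Summable fun m => ‖pT s m‖ := by
  have hg : Summable fun i : ℕ => ‖s‖ ^ i := summable_geometric_of_lt_one (norm_nonneg _) hn
  have h1 : 0 < 1 - ‖s‖ := by linarith
  refine (hg.mul_right (2 / (1 - ‖s‖) ^ 2)).of_nonneg_of_le (fun _ => norm_nonneg _) fun m => ?_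
  have h2 : ‖s ^ (2 * m + 1)‖ ≤ ‖s‖ := by
    rw [norm_pow]
    exact pow_le_of_le_one (norm_nonneg _) hn.le (by omega)
  have h3 : 1 - ‖s‖ ≤ ‖1 - s ^ (2 * m + 1)‖ := by
    have := norm_sub_norm_le 1 (s ^ (2 * m + 1))
    rw [norm_one] at this
    linarith
  have h4 : ‖1 + s ^ (2 * m + 1)‖ ≤ 2 := by
    have := norm_add_le 1 (s ^ (2 * m + 1))
    rw [norm_one] at this
    linarith
  rw [pT, norm_div, norm_mul, norm_pow, norm_pow, mul_div_assoc]
  gcongr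

lemma sum_pT_eq (hn : ‖s‖ < 1) (hs : s ≠ 0) {A B : ℂ} (hA0 : A ≠ 0) (hB0 : B ≠ 0)
    (hA : HasProd (fun i : ℕ => 1 - s ^ (2 * i + 2)) A)
    (hB : HasProd (fun i : ℕ => 1 - s ^ (2 * i + 1)) B) :
    ∑' m, pT s m = A ^ 4 / B ^ 4 := by
  have tA : Tendsto (pA s) atTop (𝓝 A) := hA.tendsto_prod_nat
  have tB : Tendsto (pB s) atTop (𝓝 B) := hB.tendsto_prod_nat
  have tU : Tendsto (pU s) atTop (𝓝 (B / A)) := tB.div tA hA0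
  obtain ⟨C, hC⟩ : ∃ C, ∀ n, ‖pU s n‖ ≤ C := by
    obtain ⟨C, hC⟩ := (Metric.isBounded_range_of_tendsto _ tU).exists_norm_le
    exact ⟨C, fun n => hC _ ⟨n, rfl⟩⟩
  have hC0 : 0 ≤ C := (norm_nonneg _).trans (hC 0)
  have T1 : Tendsto (fun n => ∑' m, if m < n + 1 then pT s m * pU s (n + 1 + m) * pU s (n - m)
      else 0) atTop (𝓝 (∑' m, pT s m * (B / A) * (B / A))) := by
    refine tendsto_tsum_of_dominated_convergence (bound := fun m => ‖pT s m‖ * C * C)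
      (((summable_pT hn).mul_right _).mul_right _) (fun m => ?_) (.of_forall fun n m => ?_)
    · have : Tendsto (fun n => pT s m * pU s (n + 1 + m) * pU s (n - m)) atTop
          (𝓝 (pT s m * (B / A) * (B / A))) := by
        refine (tendsto_const_nhds.mul (tU.comp ?_)).mul (tU.comp ?_)
        · exact tendsto_atTop_mono (fun n => by simp only [id]; omega) tendsto_id
        · exact tendsto_sub_atTop_nat m
      refine this.congr' ?_
      filter_upwards [eventually_ge_atTop m] with n hnm
      rw [if_pos (by omega)]
    · split_ifs
      · rw [norm_mul, norm_mul]
        gcongr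
        · exact hC _
        · exact hC _
      · rw [norm_zero]; positivity
  have T2 : Tendsto (fun n => pA s n ^ 2 / pB s (n + 1) ^ 2) atTop (𝓝 (A ^ 2 / B ^ 2)) :=
    (tA.pow 2).div (((tendsto_add_atTop_iff_nat 1).mpr tB).pow 2) (pow_ne_zero _ hB0)
  have T3 := tendsto_nhds_unique (T1.congr fun n => ?_) T2
  · rw [tsum_mul_right, tsum_mul_right] at T3
    field_simp at T3 ⊢
    linear_combination T3
  · rw [← finite_id hs (one_sub_ne hn) n, tsum_eq_sum (s := Finset.range (n + 1))]
    · exact Finset.sum_congr rfl fun m hm => if_pos (Finset.mem_range.mp hm)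
    · intro m hm; exact if_neg (fun h => hm (Finset.mem_range.mpr h))

lemma prod_eq (A B : ℂ) (hA0 : A ≠ 0) (hB0 : B ≠ 0)
    (hA : HasProd (fun i : ℕ => 1 - s ^ (2 * i + 2)) A)
    (hB : HasProd (fun i : ℕ => 1 - s ^ (2 * i + 1)) B) :
    ∏' n : ℕ, (1 - s ^ (2 * (n + 1))) ^ 8 / (1 - s ^ (n + 1)) ^ 4 = A ^ 4 / B ^ 4 := by
  have hBA : HasProd (fun i : ℕ => 1 - s ^ (i + 1)) (B * A) := HasProd.even_mul_odd
    (f := fun i : ℕ => 1 - s ^ (i + 1)) hB hA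
  have e : ∀ n : ℕ, s ^ (2 * (n + 1)) = s ^ (2 * n + 2) := fun n => rfl
  simp only [e]
  rw [((hA.pow 8).div₀ (hBA.pow 4) (pow_ne_zero _ (mul_ne_zero hB0 hA0))).tprod_eq]
  field_simp
end elem

lemma summable_row (z : ℂ) : Summable fun n : ℤ => 1 / (z + n) ^ 2 := by
  have := EisensteinSeries.linear_right_summable z 1 (k := 2) le_rfl
  simpa using! this

lemma row_eq (z : ℂ) (hz : 0 < z.im) : ∑' n : ℤ, 1 / (z + n) ^ 2 =
    -4 * Real.pi ^ 2 * (Complex.exp (2 * Real.pi * I * z) /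
      (1 - Complex.exp (2 * Real.pi * I * z)) ^ 2) := by
  have h := EisensteinSeries.qExpansion_identity (k := 1) le_rfl ⟨z, hz⟩
  have hx := UpperHalfPlane.norm_exp_two_pi_I_lt_one ⟨z, hz⟩
  simp only [pow_one, Nat.factorial_one, Nat.cast_one, div_one, one_add_one_eq_two] at h
  change ∑' n : ℤ, 1 / (z + n) ^ 2 = (-2 * Real.pi * I) ^ 2 *
    ∑' n : ℕ, (n : ℂ) * Complex.exp (2 * Real.pi * I * z) ^ n at h
  rw [h, tsum_coe_mul_geometric_of_norm_lt_one hx]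
  have : (-2 * (Real.pi : ℂ) * I) ^ 2 = -4 * Real.pi ^ 2 := by
    rw [mul_pow, I_sq]; ring
  rw [this]

lemma row_add_one (z : ℂ) : ∑' n : ℤ, 1 / (z + 1 + n) ^ 2 = ∑' n : ℤ, 1 / (z + n) ^ 2 := by
  rw [← (Equiv.addRight (1 : ℤ)).tsum_eq (fun n : ℤ => 1 / (z + n) ^ 2)]
  refine tsum_congr fun n => ?_
  simp only [Equiv.coe_addRight]
  push_cast
  ring

lemma row_neg (z : ℂ) : ∑' n : ℤ, 1 / (-z + n) ^ 2 = ∑' n : ℤ, 1 / (z + n) ^ 2 := by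
  rw [← (Equiv.neg ℤ).tsum_eq (fun n : ℤ => 1 / (z + n) ^ 2)]
  refine tsum_congr fun n => ?_
  simp only [Equiv.neg_apply]
  push_cast
  rw [← neg_sq]
  ring

noncomputable def dRow (h : ℂ) : ℂ :=
  ∑' n : ℤ, 1 / (h + n) ^ 2 - ∑' n : ℤ, 1 / (h + 1 / 2 + n) ^ 2

lemma dRow_neg (h : ℂ) : dRow (-h) = dRow h := by
  unfold dRow
  rw [row_neg, ← row_neg (-h + 1 / 2), ← row_add_one (-(-h + 1 / 2))]
  congr 1
  refine tsum_congr fun n => ?_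
  ring

lemma dRow_eq (h : ℂ) (hh : 0 < h.im) (x : ℂ) (hx : x = Complex.exp (2 * Real.pi * I * h)) :
    dRow h = -8 * Real.pi ^ 2 * (x * (1 + x ^ 2) / (1 - x ^ 2) ^ 2) := by
  have h2 : 0 < (h + 1 / 2).im := by simpa using hh
  have e : Complex.exp (2 * Real.pi * I * (h + 1 / 2)) = -x := by
    rw [show 2 * (Real.pi : ℂ) * I * (h + 1 / 2) = 2 * Real.pi * I * h + Real.pi * I by ring,
      Complex.exp_add, Complex.exp_pi_mul_I, hx]
    ring
  have n1 : ‖x‖ < 1 := by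
    rw [hx]; exact UpperHalfPlane.norm_exp_two_pi_I_lt_one ⟨h, hh⟩
  have a1 : 1 - x ≠ 0 := by
    intro h0
    rw [← sub_eq_zero.mp h0, norm_one] at n1
    exact lt_irrefl _ n1
  have a2 : 1 + x ≠ 0 := by
    intro h0
    rw [eq_neg_of_add_eq_zero_right h0, norm_neg, norm_one] at n1
    exact lt_irrefl _ n1
  have a3 : (1 - x ^ 2) = (1 - x) * (1 + x) := by ring
  unfold dRow
  rw [row_eq h hh, row_eq _ h2, e, ← hx, a3, sub_neg_eq_add]
  field_simp
  ring

lemma odd_lin_ne {T : ℂ} (hT : 0 < T.im) (m k : ℤ) : ((2 * m + 1 : ℤ) : ℂ) * T + k ≠ 0 := by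
  intro h
  have := congrArg Complex.im h
  simp only [add_im, mul_im, intCast_re, intCast_im, zero_mul, add_zero, zero_im,
    mul_eq_zero] at this
  rcases this with h1 | h1
  · have : (2 * m + 1 : ℤ) = 0 := by exact_mod_cast h1
    omega
  · linarith

lemma summable_cube {T : ℂ} (hT : 0 < T.im) :
    Summable fun x : Fin 2 → ℤ => (‖(x 0 : ℂ) * T + x 1‖⁻¹) ^ 3 := by
  have h := (EisensteinSeries.summable_one_div_norm_rpow (k := 3) (by norm_num)).mul_left
    (EisensteinSeries.r ⟨T, hT⟩ ^ (-(3 : ℝ)))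
  refine h.of_nonneg_of_le (fun x => by positivity) fun x => ?_
  refine le_trans (le_of_eq ?_) (EisensteinSeries.summand_bound ⟨T, hT⟩ (k := 3) (by norm_num) x)
  rw [Real.rpow_neg (norm_nonneg _), inv_pow]
  norm_cast

lemma summable_main {T : ℂ} (hT : 0 < T.im) : Summable fun p : ℤ × ℤ =>
      (1 / (1 / 2 + ((p.1 : ℂ) + 1 / 2) + ((p.2 : ℂ) + 1 / 2) * T) ^ 2 -
        1 / (((p.1 : ℂ) + 1 / 2) + ((p.2 : ℂ) + 1 / 2) * T) ^ 2) := by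
  have hc := summable_cube hT
  have s1 := hc.comp_injective (i := fun p : ℤ × ℤ => ![2 * p.2 + 1, 2 * p.1 + 2]) (by
    intro p p' h
    have h0 := congrFun h 0
    have h1 := congrFun h 1
    simp at h0 h1
    ext <;> simp [h0, h1])
  have s2 := hc.comp_injective (i := fun p : ℤ × ℤ => ![2 * p.2 + 1, 2 * p.1 + 1]) (by
    intro p p' h
    have h0 := congrFun h 0
    have h1 := congrFun h 1
    simp at h0 h1
    ext <;> simp [h0, h1])
  refine Summable.of_norm_bounded ((s1.add s2).mul_left 4) fun p => ?_
  obtain ⟨n, m⟩ := p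
  have hA := odd_lin_ne hT m (2 * n + 2)
  have hB := odd_lin_ne hT m (2 * n + 1)
  simp only [Function.comp, Matrix.cons_val_zero, Matrix.cons_val_one]
  set a : ℂ := ((2 * m + 1 : ℤ) : ℂ) * T + (2 * n + 2 : ℤ) with ha
  set b : ℂ := ((2 * m + 1 : ℤ) : ℂ) * T + (2 * n + 1 : ℤ) with hb
  have hab : a = b + 1 := by rw [ha, hb]; push_cast; ring
  have e1 : (1 / 2 + ((n : ℂ) + 1 / 2) + ((m : ℂ) + 1 / 2) * T) = a / 2 := by
    rw [ha]; push_cast; ring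
  have e2 : (((n : ℂ) + 1 / 2) + ((m : ℂ) + 1 / 2) * T) = b / 2 := by
    rw [hb]; push_cast; ring
  rw [e1, e2]
  have e3 : 1 / (a / 2) ^ 2 - 1 / (b / 2) ^ 2 = -4 * (a⁻¹ * b⁻¹ * (a⁻¹ + b⁻¹)) := by
    field_simp
    rw [hab]; ring
  rw [e3, norm_mul, norm_mul, norm_mul, ← norm_inv, ← norm_inv]
  have e4 : ‖(-4 : ℂ)‖ = 4 := by simp
  rw [e4]
  have e5 := norm_add_le a⁻¹ b⁻¹
  have x0 := norm_nonneg a⁻¹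
  have y0 := norm_nonneg b⁻¹
  generalize ‖a⁻¹‖ = x at *
  generalize ‖b⁻¹‖ = y at *
  have : x * y * ‖a⁻¹ + b⁻¹‖ ≤ x * y * (x + y) := by gcongr
  nlinarith [mul_nonneg (add_nonneg x0 y0) (sq_nonneg (x - y))]

lemma wpt_eq_s16 {τ : ℂ} (hτ : 0 < τ.im) :
    wpt (1 / 2) (2 * τ) = (Real.pi : ℂ)⁻¹ ^ 2 * ∑' m : ℤ, dRow ((2 * m + 1) * τ) := by
  have hT : 0 < (2 * τ).im := by simpa using hτ
  have hS := summable_main hT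
  unfold wpt
  congr 1
  rw [hS.tsum_prod, ← Summable.tsum_comm (by exact hS)]
  refine tsum_congr fun m => ?_
  unfold dRow
  rw [← row_add_one, ← Summable.tsum_sub (summable_row _) (summable_row _)]
  refine tsum_congr fun n => ?_
  ring_nf

lemma wpt_eq' {τ : ℂ} (hτ : 0 < τ.im) (q : ℂ) (hq : q = Complex.exp (2 * Real.pi * I * τ))
    (hsum : Summable (pT (q ^ 2))) :
    -(1 / 16) * wpt (1 / 2) (2 * τ) = q * ∑' m : ℕ, pT (q ^ 2) m := by
  have hpos : ∀ m : ℕ, dRow ((2 * ((m : ℤ) : ℂ) + 1) * τ) =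
      -8 * Real.pi ^ 2 * q * pT (q ^ 2) m := by
    intro m
    have him : 0 < ((2 * ((m : ℤ) : ℂ) + 1) * τ : ℂ).im := by
      have : ((2 * ((m : ℤ) : ℂ) + 1) * τ : ℂ) = ((2 * m + 1 : ℝ) : ℂ) * τ := by push_cast; ring
      rw [this, im_ofReal_mul]
      positivity
    rw [dRow_eq _ him (q ^ (2 * m + 1))]
    · unfold pT
      ring
    · rw [hq, ← Complex.exp_nat_mul]
      congr 1
      push_cast
      ring
  have hneg : ∀ m : ℕ, dRow ((2 * ((-((m : ℤ) + 1) : ℤ) : ℂ) + 1) * τ) =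
      -8 * Real.pi ^ 2 * q * pT (q ^ 2) m := by
    intro m
    rw [← hpos, ← dRow_neg]
    congr 1
    push_cast
    ring
  have hs' : Summable fun m => -8 * Real.pi ^ 2 * q * pT (q ^ 2) m := hsum.mul_left _
  rw [wpt_eq_s16 hτ, tsum_of_nat_of_neg_add_one]
  · simp only [hpos, hneg, tsum_mul_left]
    have : (Real.pi : ℂ) ≠ 0 := by exact_mod_cast Real.pi_ne_zero
    field_simp
    ring
  · simpa only [hpos] using hs'
  · simpa only [hneg] using hs'

/-- With `q = e^{2πiτ}`, `−(1/16) ℘̃a(1/2, 2τ) = q Π_{n≥1} (1−q^{4n})^8/(1−q^{2n})^4`,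
the level-4 strong modular unit `Δ₄(τ) = η(4τ)^8 η(2τ)^{−4}`. -/
theorem delta4_eta_quotient (τ : ℂ) (hτ : 0 < τ.im) :
    -(1 / 16) * wpt (1 / 2) (2 * τ) =
      Complex.exp (2 * Real.pi * Complex.I * τ) *
        ∏' n : ℕ,
          (1 - Complex.exp (2 * Real.pi * Complex.I * τ) ^ (4 * (n + 1))) ^ 8 /
            (1 - Complex.exp (2 * Real.pi * Complex.I * τ) ^ (2 * (n + 1))) ^ 4 := by
  set q := Complex.exp (2 * Real.pi * Complex.I * τ) with hq
  have hq1 : ‖q‖ < 1 := UpperHalfPlane.norm_exp_two_pi_I_lt_one ⟨τ, hτ⟩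
  have hq0 : q ≠ 0 := Complex.exp_ne_zero _
  have hs1 : ‖q ^ 2‖ < 1 := by
    rw [norm_pow]; exact pow_lt_one₀ (norm_nonneg _) hq1 two_ne_zero
  obtain ⟨A, B, hA0, hB0, hA, hB⟩ := exists_limits hs1
  rw [wpt_eq' hτ q hq (summable_pT hs1).of_norm,
    sum_pT_eq hs1 (pow_ne_zero 2 hq0) hA0 hB0 hA hB, ← prod_eq A B hA0 hB0 hA hB]
  congr 1
  refine tprod_congr fun n => ?_
  rw [← pow_mul, ← pow_mul, show 2 * (2 * (n + 1)) = 4 * (n + 1) by ring]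
end

section
/- For every τ in the upper half-plane H, with q = e^{2πiτ}, the modular discriminant satisfies Δ(τ) = q · Π_{n=1}^{∞} (1−q^{n})^{24} = (1/256)·( ℘̃a(1/2, τ) · ℘̃a(τ/2, τ) · ℘̃a((τ+1)/2, τ+1) )². -/
open Complex

namespace WptAux
open PeriodPair Filter Topology

lemma deriv_half (L : PeriodPair) (w : ℂ) (hw : 2 * w ∈ L.lattice) :
    L.derivWeierstrassP w = 0 := by
  have h := L.derivWeierstrassP_neg w
  have h2 := L.derivWeierstrassP_sub_coe w ⟨2 * w, hw⟩
  simp only at h2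
  rw [show w - 2 * w = -w by ring, h] at h2
  exact self_eq_neg.mp h2.symm

/-- `℘` takes distinct values at inequivalent half periods. -/
lemma half_ne (L : PeriodPair) (w v : ℂ) (hw : w ∉ L.lattice) (hw2 : 2 * w ∈ L.lattice)
    (hv : v ∉ L.lattice) (hvw : v + w ∉ L.lattice) :
    L.weierstrassP v ≠ L.weierstrassP w := by
  classical
  intro heq
  set e := L.weierstrassP w with he
  have hper : ∀ z, ∀ l ∈ L.lattice, L.weierstrassP (z + l) = L.weierstrassP z :=
    fun z l hl => L.weierstrassP_add_coe z ⟨l, hl⟩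
  -- local structure at `w`
  have han : AnalyticAt ℂ (fun z => L.weierstrassP z - e) w :=
    (L.analyticOnNhd_weierstrassP w hw).sub analyticAt_const
  obtain ⟨k, hk, hke⟩ := (natCast_le_analyticOrderAt han (n := 2)).mp (by
    refine (natCast_le_analyticOrderAt_iff_iteratedDeriv_eq_zero han).mpr fun i hi => ?_
    obtain rfl | rfl : i = 0 ∨ i = 1 := by omega
    · simp [he]
    · simp [deriv_half L w hw2])
  set P : ℂ → ℂ := fun z => (L.weierstrassP z - e) * (L.weierstrassP (z + w) - e) with hP
  set S : Set ℂ := {z | z ∈ L.lattice ∨ z + w ∈ L.lattice} with hS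
  have hmem : ∀ z, ∀ l ∈ L.lattice, z + l ∈ L.lattice ↔ z ∈ L.lattice := fun z l hl =>
    L.lattice.toAddSubgroup.add_mem_cancel_right (y := z) hl
  have hSw : ∀ z, z + w ∈ S ↔ z ∈ S := by
    intro z
    simp only [hS, Set.mem_ofPred_eq]
    rw [show z + w + w = z + 2 * w by ring, hmem z _ hw2]
    tauto
  have hPw : ∀ z, P (z + w) = P z := by
    intro z
    simp only [hP]
    rw [show z + w + w = z + 2 * w by ring, hper z _ hw2]
    ring
  have hSl : ∀ z, ∀ l ∈ L.lattice, z + l ∈ S ↔ z ∈ S := by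
    intro z l hl
    simp only [hS, Set.mem_ofPred_eq]
    rw [show z + l + w = z + w + l by ring, hmem z _ hl, hmem (z + w) _ hl]
  have hPl : ∀ z, ∀ l ∈ L.lattice, P (z + l) = P z := by
    intro z l hl
    simp only [hP]
    rw [show z + l + w = z + w + l by ring, hper z _ hl, hper (z + w) _ hl]
  set F : ℂ → ℂ := fun z => if z ∈ S then k w else P z with hF
  have hFw : ∀ z, F (z + w) = F z := by intro z; simp only [hF, hSw, hPw]
  have hFl : ∀ z, ∀ l ∈ L.lattice, F (z + l) = F z := by
    intro z l hl; simp only [hF, hSl z l hl, hPl z l hl]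
  have hSclosed : IsClosed S := by
    have h1 := L.isClosed_lattice
    exact h1.union (h1.preimage (by fun_prop : Continuous fun z : ℂ => z + w))
  have hF0 : AnalyticAt ℂ F 0 := by
    have hkc : AnalyticAt ℂ (fun z => k (z + w)) 0 := by
      have : AnalyticAt ℂ k (0 + w) := by simpa using hk
      exact this.fun_comp (f := fun z : ℂ => z + w) (by fun_prop)
    have hX := L.analyticAt_weierstrassPExcept 0
    have hG : AnalyticAt ℂ (fun z => (1 + z ^ 2 * (L.weierstrassPExcept 0 z - e)) * k (z + w)) 0 := by
      refine AnalyticAt.fun_mul ?_ hkc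
      fun_prop
    refine hG.congr ?_
    have e1 : ∀ᶠ z in 𝓝 (0 : ℂ), L.weierstrassP (z + w) - e = (z + w - w) ^ 2 • k (z + w) := by
      have : Tendsto (fun z : ℂ => z + w) (𝓝 0) (𝓝 w) := by
        have : Continuous fun z : ℂ => z + w := by fun_prop
        simpa using this.tendsto 0
      exact this.eventually hke
    have e2 : ∀ᶠ z in 𝓝 (0 : ℂ), z + w ∉ L.lattice := by
      have : IsOpen {z : ℂ | z + w ∉ L.lattice} :=
        (L.isClosed_lattice.preimage (by fun_prop : Continuous fun z : ℂ => z + w)).isOpen_compl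
      exact this.mem_nhds (by simpa using hw)
    have e3 := L.compl_lattice_sdiff_singleton_mem_nhds 0
    filter_upwards [e1, e2, e3] with z h1 h2 h3
    by_cases hz : z = 0
    · subst hz
      simp [hF, hS]
    · have h4 : z ∉ L.lattice := fun h => h3 ⟨h, hz⟩
      have h5 := L.weierstrassPExcept_add 0 z
      simp only [ZeroMemClass.coe_zero] at h5
      simp only [hF, hS, Set.mem_ofPred_eq, h4, h2, or_self, if_false, hP]
      rw [h1, ← h5]
      simp only [smul_eq_mul]
      field_simp
      ring
  have hFan : ∀ x, AnalyticAt ℂ F x := by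
    have key : ∀ a : ℂ, (∀ z, F (z + a) = F z) → AnalyticAt ℂ F a := by
      intro a ha
      have h0 : AnalyticAt ℂ F (a - a) := by simpa using hF0
      have := h0.fun_comp (f := fun z : ℂ => z - a) (by fun_prop)
      convert this using 1
      ext z
      rw [← ha (z - a), sub_add_cancel]
    intro x
    by_cases hx : x ∈ S
    · rcases hx with hx | hx
      · exact key x fun z => hFl z x hx
      · refine key x fun z => ?_
        rw [← hFw (z + x), add_assoc, hFl z _ hx]
    · have h1 : x ∉ L.lattice := fun h => hx (Or.inl h)
      have h2 : x + w ∉ L.lattice := fun h => hx (Or.inr h)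
      have a1 := L.analyticOnNhd_weierstrassP _ h1
      have a2 : AnalyticAt ℂ (fun z => L.weierstrassP (z + w)) x :=
        (L.analyticOnNhd_weierstrassP _ h2).fun_comp (f := fun z : ℂ => z + w) (by fun_prop)
      have : AnalyticAt ℂ P x := by fun_prop
      refine this.congr ?_
      filter_upwards [hSclosed.isOpen_compl.mem_nhds hx] with z hz
      exact (if_neg hz).symm
  have hdiff : Differentiable ℂ F := fun x => (hFan x).differentiableAt
  have hconst : ∀ x, F x = 0 := by
    intro x
    have h1 := hdiff.apply_eq_apply_of_bounded (IsZLattice.isCompact_range_of_periodic L.lattice _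
      hdiff.continuous fun z l hl => hFl z l hl).isBounded x v
    rw [h1]
    simp [hF, hS, hv, hvw, hP, heq]
  -- contradiction by orders
  have hm := L.meromorphic_weierstrassP
  have ho : ∃ u, meromorphicOrderAt (fun z => L.weierstrassP z - e) u ≠ ⊤ := by
    refine ⟨0, fun htop => ?_⟩
    rw [meromorphicOrderAt_eq_top_iff] at htop
    have h1 := L.order_weierstrassP 0 L.lattice.zero_mem
    have h2 : L.weierstrassP =ᶠ[𝓝[≠] 0] fun _ => e := htop.mono fun z hz => sub_eq_zero.mp hz
    rw [meromorphicOrderAt_congr h2, meromorphicOrderAt_const] at h1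
    split_ifs at h1
    · exact WithTop.top_ne_coe (a := (-2 : ℤ)) h1
    · exact absurd (WithTop.coe_injective (a₁ := (0 : ℤ)) (a₂ := -2) h1) (by norm_num)
  have hall := ((Meromorphic.exists_meromorphicOrderAt_ne_top_iff_forall (by fun_prop)).mp ho)
  have hne : ∀ u, ∀ᶠ z in 𝓝[≠] u, L.weierstrassP z - e ≠ 0 := fun u =>
    (meromorphicOrderAt_ne_top_iff_eventually_ne_zero ((hm u).sub (MeromorphicAt.const e u))).mp (hall u)
  have ht : Tendsto (fun z : ℂ => z + w) (𝓝[≠] v) (𝓝[≠] (v + w)) := by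
    refine tendsto_nhdsWithin_iff.mpr ⟨?_, ?_⟩
    · have : Continuous fun z : ℂ => z + w := by fun_prop
      exact (this.tendsto v).mono_left nhdsWithin_le_nhds
    · filter_upwards [self_mem_nhdsWithin] with z hz
      simpa using hz
  have hvS : v ∉ S := by simp [hS, hv, hvw]
  obtain ⟨z, h1, h2, h3⟩ := ((hne v).and ((ht.eventually (hne (v + w))).and
    (mem_nhdsWithin_of_mem_nhds (hSclosed.isOpen_compl.mem_nhds hvS)))).exists
  have h4 := hconst z
  rw [hF] at h4
  simp only [if_neg h3] at h4
  exact mul_ne_zero h1 h2 h4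
end WptAux

namespace WptAux
open PeriodPair Filter Topology

/-- The period pair `(1, τ)`. -/
noncomputable def pp (τ : ℂ) (hτ : 0 < τ.im) : PeriodPair where
  ω₁ := 1
  ω₂ := τ
  indep := by
    rw [LinearIndependent.pair_iff]
    intro s t h
    have h1 := congrArg Complex.im h
    have h2 := congrArg Complex.re h
    simp at h1 h2
    rcases h1 with h1 | h1
    · subst h1; simpa using h2
    · exact absurd h1 hτ.ne'

lemma mem_pp {τ : ℂ} {hτ : 0 < τ.im} {x : ℂ} :
    x ∈ (pp τ hτ).lattice ↔ ∃ m n : ℤ, (m : ℂ) + n * τ = x := by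
  rw [mem_lattice]; simp [pp]

lemma wpt_eq (τ : ℂ) (hτ : 0 < τ.im) (z : ℂ) :
    wpt z τ = (Real.pi : ℂ)⁻¹ ^ 2 * ((pp τ hτ).weierstrassP (z + (1 + τ) / 2) -
      (pp τ hτ).weierstrassP ((1 + τ) / 2)) := by
  set L := pp τ hτ with hL
  unfold wpt
  congr 1
  have h := (L.hasSum_weierstrassP (z + (1 + τ) / 2)).sub (L.hasSum_weierstrassP ((1 + τ) / 2))
  rw [← (L.latticeEquivProd.symm.toEquiv.trans (Equiv.neg _)).hasSum_iff] at h
  rw [← h.tsum_eq]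
  congr 1
  ext p
  have := L.latticeEquiv_symm_apply p
  simp only [Function.comp_apply, Equiv.trans_apply, Equiv.neg_apply, NegMemClass.coe_neg,
    LinearEquiv.coe_toEquiv, this]
  simp only [hL, pp, mul_one]
  ring_nf

lemma P_congr (L M : PeriodPair) (h : L.lattice = M.lattice) : L.weierstrassP = M.weierstrassP := by
  ext z
  unfold weierstrassP
  rw [h]

lemma G_eq (τ : UpperHalfPlane) {k : ℕ} (hk : 3 ≤ k) :
    (pp τ τ.2).G k = 2 * riemannZeta k * ModularForm.E hk τ := by
  have h := tsum_eisSummand_eq_riemannZeta_mul_eisensteinSeries hk τ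
  have h2 : ModularForm.E hk τ = (1 / 2 : ℂ) * eisensteinSeries (N := 1) 0 k τ := rfl
  rw [h2]
  have : 2 * riemannZeta k * ((1 / 2 : ℂ) * eisensteinSeries (N := 1) 0 k τ) =
    riemannZeta k * eisensteinSeries (N := 1) 0 k τ := by ring
  rw [this, ← h]
  unfold G
  rw [← (pp τ τ.2).latticeEquivProd.symm.toEquiv.tsum_eq, ← ((Equiv.prodComm ℤ ℤ).trans (finTwoArrowEquiv ℤ).symm).tsum_eq]
  congr 1
  ext p
  have := (pp τ τ.2).latticeEquiv_symm_apply p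
  simp only [LinearEquiv.coe_toEquiv, this]
  simp [pp, EisensteinSeries.eisSummand, add_comm]

lemma zeta_six : riemannZeta 6 = Real.pi ^ 6 / 945 := by
  have h := riemannZeta_two_mul_nat (k := 3) (by norm_num)
  have hb : bernoulli 6 = 1 / 42 := by
    rw [bernoulli_eq_bernoulli'_of_ne_one (by norm_num), bernoulli'_def]
    norm_num [Finset.sum_range_succ, Nat.choose, bernoulli'_two, bernoulli'_four,
      bernoulli'_eq_zero_of_odd (n := 5) (by decide) (by norm_num)]
  norm_num [hb, Nat.factorial] at h
  rw [h]
  ring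

lemma disc_eq (τ : UpperHalfPlane) :
    (pp τ τ.2).g₂ ^ 3 - 27 * (pp τ τ.2).g₃ ^ 2 =
      4096 * Real.pi ^ 12 * ModularForm.discriminant τ := by
  have h4 := G_eq τ (k := 4) (by norm_num)
  have h6 := G_eq τ (k := 6) (by norm_num)
  have hz4 := riemannZeta_four
  have hz6 := zeta_six
  push_cast at h4 h6
  rw [g₂, g₃, h4, h6, hz4, hz6, ModularForm.discriminant_eq_E₄_cube_sub_E₆_sq]
  ring

lemma alg {g2 g3 a b c : ℂ} (hab : a ≠ b) (hac : a ≠ c) (hbc : b ≠ c)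
    (ha : 0 = 4 * a ^ 3 - g2 * a - g3) (hb : 0 = 4 * b ^ 3 - g2 * b - g3)
    (hc : 0 = 4 * c ^ 3 - g2 * c - g3) :
    g2 ^ 3 - 27 * g3 ^ 2 = 16 * ((b - c) * (a - c) * (a - b)) ^ 2 := by
  have h1 : g2 = 4 * (a ^ 2 + a * b + b ^ 2) :=
    mul_left_cancel₀ (sub_ne_zero.mpr hab) (by linear_combination ha - hb)
  have h2 : g2 = 4 * (a ^ 2 + a * c + c ^ 2) :=
    mul_left_cancel₀ (sub_ne_zero.mpr hac) (by linear_combination ha - hc)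
  have h3 : c = -a - b :=
    mul_left_cancel₀ (sub_ne_zero.mpr hbc) (by linear_combination (h2 - h1) / 4)
  have h4 : g3 = 4 * a ^ 3 - g2 * a := by linear_combination ha
  subst h3
  rw [h4, h1]
  ring

end WptAux

/-- The discriminant as a product of half-period values. -/
theorem discriminant_wpt_product (τ : ℂ) (hτ : 0 < τ.im) :
    Complex.exp (2 * Real.pi * Complex.I * τ) *
        ∏' n : ℕ, (1 - Complex.exp (2 * Real.pi * Complex.I * τ) ^ (n + 1)) ^ 24 =
      1 / 256 *
        (wpt (1 / 2) τ * wpt (τ / 2) τ * wpt ((τ + 1) / 2) (τ + 1)) ^ 2 := by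
  have hD := ModularForm.discriminant_eq_q_prod ⟨τ, hτ⟩
  have hE := WptAux.disc_eq ⟨τ, hτ⟩
  simp only [ModularForm.eta_q_eq_pow] at hD
  have hq : Function.Periodic.qParam 1 τ = Complex.exp (2 * Real.pi * Complex.I * τ) := by
    simp [Function.Periodic.qParam]
  change _ = Function.Periodic.qParam 1 τ * _ at hD
  rw [hq] at hD
  change (WptAux.pp τ hτ).g₂ ^ 3 - 27 * (WptAux.pp τ hτ).g₃ ^ 2 = _ at hE
  refine hD.symm.trans ?_
  have hτ' : 0 < (τ + 1).im := by simpa using hτ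
  rw [WptAux.wpt_eq τ hτ, WptAux.wpt_eq τ hτ, WptAux.wpt_eq (τ + 1) hτ']
  have hlat : (WptAux.pp (τ + 1) hτ').lattice = (WptAux.pp τ hτ).lattice := by
    ext x
    rw [WptAux.mem_pp, WptAux.mem_pp]
    constructor
    · rintro ⟨m, n, rfl⟩; exact ⟨m + n, n, by push_cast; ring⟩
    · rintro ⟨m, n, rfl⟩; exact ⟨m - n, n, by push_cast; ring⟩
  rw [WptAux.P_congr _ _ hlat]
  set L := WptAux.pp τ hτ with hL
  have hper : ∀ z : ℂ, ∀ m n : ℤ, L.weierstrassP (z + (m + n * τ)) = L.weierstrassP z :=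
    fun z m n => L.weierstrassP_add_coe z ⟨_, WptAux.mem_pp.mpr ⟨m, n, rfl⟩⟩
  have r1 : L.weierstrassP (1 / 2 + (1 + τ) / 2) = L.weierstrassP (τ / 2) := by
    rw [← hper (τ / 2) 1 0]; congr 1; push_cast; ring
  have r2 : L.weierstrassP (τ / 2 + (1 + τ) / 2) = L.weierstrassP (1 / 2) := by
    rw [← hper (1 / 2) 0 1]; congr 1; push_cast; ring
  have r3 : L.weierstrassP ((τ + 1) / 2 + (1 + (τ + 1)) / 2) = L.weierstrassP (1 / 2) := by
    rw [← hper (1 / 2) 1 1]; congr 1; push_cast; ring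
  have r4 : L.weierstrassP ((1 + (τ + 1)) / 2) = L.weierstrassP (τ / 2) := by
    rw [← hper (τ / 2) 1 0]; congr 1; push_cast; ring
  rw [r1, r2, r3, r4]
  -- membership facts
  have hmem : ∀ a b : ℤ, (a : ℂ) / 2 + b * τ / 2 ∈ L.lattice → 2 ∣ a ∧ 2 ∣ b := by
    intro a b h
    obtain ⟨m, n, h⟩ := WptAux.mem_pp.mp h
    have h1 := congrArg Complex.im h
    have h2 := congrArg Complex.re h
    simp at h1 h2
    have e1 : (b : ℝ) = 2 * n :=
      mul_right_cancel₀ hτ.ne' (by linarith)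
    have e2 : (a : ℝ) = 2 * m := by
      rw [e1] at h2; linarith
    exact ⟨⟨m, by exact_mod_cast e2⟩, ⟨n, by exact_mod_cast e1⟩⟩
  have m1 : (1 / 2 : ℂ) ∉ L.lattice := fun h => by
    have := hmem 1 0 (by simpa using h); omega
  have m2 : τ / 2 ∉ L.lattice := fun h => by
    have := hmem 0 1 (by simpa using h); omega
  have m3 : (1 + τ) / 2 ∉ L.lattice := fun h => by
    have := hmem 1 1 (by convert h using 1; push_cast; ring); omega
  have d1 : 2 * (1 / 2 : ℂ) ∈ L.lattice := WptAux.mem_pp.mpr ⟨1, 0, by push_cast; ring⟩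
  have d2 : 2 * (τ / 2) ∈ L.lattice := WptAux.mem_pp.mpr ⟨0, 1, by push_cast; ring⟩
  have d3 : 2 * ((1 + τ) / 2) ∈ L.lattice := WptAux.mem_pp.mpr ⟨1, 1, by push_cast; ring⟩
  have n12 : L.weierstrassP (1 / 2) ≠ L.weierstrassP (τ / 2) :=
    WptAux.half_ne L _ _ m2 d2 m1 (by convert m3 using 2; ring)
  have n13 : L.weierstrassP (1 / 2) ≠ L.weierstrassP ((1 + τ) / 2) :=
    WptAux.half_ne L _ _ m3 d3 m1 (fun h => by
      have := hmem 2 1 (by convert h using 1; push_cast; ring); omega)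
  have n23 : L.weierstrassP (τ / 2) ≠ L.weierstrassP ((1 + τ) / 2) :=
    WptAux.half_ne L _ _ m3 d3 m2 (fun h => by
      have := hmem 1 2 (by convert h using 1; push_cast; ring); omega)
  have o1 := L.derivWeierstrassP_sq _ m1
  have o2 := L.derivWeierstrassP_sq _ m2
  have o3 := L.derivWeierstrassP_sq _ m3
  rw [WptAux.deriv_half L _ d1, zero_pow two_ne_zero] at o1
  rw [WptAux.deriv_half L _ d2, zero_pow two_ne_zero] at o2
  rw [WptAux.deriv_half L _ d3, zero_pow two_ne_zero] at o3
  have hfin := WptAux.alg n12 n13 n23 o1 o2 o3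
  rw [hE] at hfin
  have hpi : (Real.pi : ℂ) ≠ 0 := by exact_mod_cast Real.pi_ne_zero
  refine mul_left_cancel₀ (b := ModularForm.discriminant ⟨τ, hτ⟩)
    (mul_ne_zero (by norm_num : (4096 : ℂ) ≠ 0) (pow_ne_zero 12 hpi)) (hfin.trans ?_)
  field_simp
  ring
end

section
/- For every τ in the upper half-plane H, with q = e^{2πiτ}, the weight-4 Eisenstein series E₄(τ) = 1 + 240 Σ_{n=1}^{∞} σ₃(n) qⁿ satisfies E₄(τ) = (1/2)·( ℘̃a(1/2,τ)² + ℘̃a(τ/2,τ)² + ℘̃a((τ+1)/2, τ+1)² ) = 3·( ℘a(1/2,τ)² + ℘a(τ/2,τ)² + ℘a(1/2,τ)·℘a(τ/2,τ) ). -/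
open Complex

open Filter Topology

lemma aux_order_deriv (L : PeriodPair) (w : ℂ) :
    meromorphicOrderAt L.derivWeierstrassP w ≠ ⊤ := by
  have h0 : meromorphicOrderAt L.derivWeierstrassP 0 ≠ ⊤ := by
    rw [← L.deriv_weierstrassP]
    rw [meromorphicOrderAt_deriv_eq_sub_one (n := -2)]
    · simp
    · norm_num
    · have := L.order_weierstrassP 0 (zero_mem _)
      simpa using this
  exact MeromorphicOn.meromorphicOrderAt_ne_top_of_isPreconnected (U := Set.univ)
    (fun x _ => L.meromorphic_derivWeierstrassP x) isPreconnected_univ (Set.mem_univ _)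
    (Set.mem_univ _) h0

lemma aux_wp_second (L : PeriodPair) (w : ℂ) (hw : w ∉ L.lattice) :
    6 * L.sumInvPow w 4 = 6 * L.weierstrassP w ^ 2 - L.g₂ / 2 := by
  have hopen : IsOpen ((L.lattice : Set ℂ)ᶜ) := L.isClosed_lattice.isOpen_compl
  have hd : deriv L.derivWeierstrassP w = 6 * L.sumInvPow w 4 := by
    rw [← L.deriv_derivWeierstrassPExcept_self w, L.derivWeierstrassPExcept_of_notMem w hw]
  have ha := L.analyticOnNhd_derivWeierstrassP w hw
  have hb := L.analyticOnNhd_weierstrassP w hw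
  have hev : ∀ᶠ z in 𝓝 w, L.derivWeierstrassP z *
      (2 * deriv L.derivWeierstrassP z - 12 * L.weierstrassP z ^ 2 + L.g₂) = 0 := by
    filter_upwards [hopen.mem_nhds hw] with z hz
    have h1 : HasDerivAt L.derivWeierstrassP (deriv L.derivWeierstrassP z) z :=
      (L.analyticOnNhd_derivWeierstrassP z hz).differentiableAt.hasDerivAt
    have h2 : HasDerivAt L.weierstrassP (L.derivWeierstrassP z) z := by
      rw [← L.deriv_weierstrassP]
      exact (L.analyticOnNhd_weierstrassP z hz).differentiableAt.hasDerivAt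
    have h3 := h1.fun_pow 2
    have h4 := (((h2.fun_pow 3).const_mul 4).sub (h2.const_mul L.g₂)).sub_const L.g₃
    have h5 : (fun z => L.derivWeierstrassP z ^ 2) =ᶠ[𝓝 z]
        ((fun z => 4 * L.weierstrassP z ^ 3) - fun z => L.g₂ * L.weierstrassP z) - fun _ => L.g₃ := by
      filter_upwards [hopen.mem_nhds hz] with y hy
      exact L.derivWeierstrassP_sq y hy
    have h6 := h3.unique (h4.congr_of_eventuallyEq h5)
    simp only [Nat.cast_ofNat, Nat.reduceSub, pow_one] at h6
    linear_combination h6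
  have hne : ∃ᶠ z in 𝓝[≠] w, L.derivWeierstrassP z ≠ 0 := by
    have := aux_order_deriv L w
    rw [Ne, meromorphicOrderAt_eq_top_iff] at this
    exact fun h => this (h.mono fun z hz => not_not.1 hz)
  have hanal : AnalyticAt ℂ (fun z =>
      2 * deriv L.derivWeierstrassP z - 12 * L.weierstrassP z ^ 2 + L.g₂) w := by
    have := ha.deriv
    fun_prop
  have := (hanal.frequently_zero_iff_eventually_zero.1
    ((hne.and_eventually (hev.filter_mono nhdsWithin_le_nhds)).mono
      fun z hz => (mul_eq_zero.1 hz.2).resolve_left hz.1)).self_of_nhds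
  rw [hd] at this
  linear_combination this / 2

lemma aux_indep (τ : ℂ) (hτ : 0 < τ.im) : LinearIndependent ℝ ![(1 : ℂ), τ] := by
  rw [LinearIndependent.pair_iff]
  intro s t h
  have h2 := congrArg Complex.im h
  have h1 := congrArg Complex.re h
  simp at h1 h2
  rcases h2 with h2 | h2
  · subst h2; simpa using h1
  · exact absurd h2 hτ.ne'

/-- the period pair of `τ` -/
noncomputable def auxL (τ : ℂ) (hτ : 0 < τ.im) : PeriodPair := ⟨1, τ, aux_indep τ hτ⟩

lemma aux_hasSum_wp (τ : ℂ) (hτ : 0 < τ.im) (z : ℂ) :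
    HasSum (fun p : ℤ × ℤ => 1 / (z - ((p.1 : ℂ) + (p.2 : ℂ) * τ)) ^ 2
      - 1 / ((p.1 : ℂ) + (p.2 : ℂ) * τ) ^ 2) ((auxL τ hτ).weierstrassP z) := by
  have h := (auxL τ hτ).hasSum_weierstrassP z
  rw [← (auxL τ hτ).latticeEquivProd.symm.toEquiv.hasSum_iff] at h
  convert h using 2 with p
  have := (auxL τ hτ).latticeEquiv_symm_apply p
  change (((auxL τ hτ).latticeEquivProd.symm.toEquiv p : (auxL τ hτ).lattice) : ℂ) = _ at this
  simp only [Function.comp, this]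
  simp [auxL]

lemma aux_hasSum_inv (τ : ℂ) (hτ : 0 < τ.im) (z : ℂ) :
    HasSum (fun p : ℤ × ℤ => ((((p.1 : ℂ) + (p.2 : ℂ) * τ) - z) ^ 4)⁻¹)
      ((auxL τ hτ).sumInvPow z 4) := by
  have h := (auxL τ hτ).hasSum_sumInvPow z (r := 4) (by norm_num)
  rw [← (auxL τ hτ).latticeEquivProd.symm.toEquiv.hasSum_iff] at h
  convert h using 2 with p
  have := (auxL τ hτ).latticeEquiv_symm_apply p
  change (((auxL τ hτ).latticeEquivProd.symm.toEquiv p : (auxL τ hτ).lattice) : ℂ) = _ at this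
  simp only [Function.comp, this]
  simp [auxL]

lemma aux_mem (τ : ℂ) (hτ : 0 < τ.im) (a b : ℤ) :
    (a : ℂ) + b * τ ∈ (auxL τ hτ).lattice := by
  rw [PeriodPair.mem_lattice]; exact ⟨a, b, by simp [auxL]⟩

lemma aux_notMem (τ : ℂ) (hτ : 0 < τ.im) (a b : ℚ) (h : ¬ (a.den = 1 ∧ b.den = 1)) :
    (a : ℂ) + b * τ ∉ (auxL τ hτ).lattice := by
  have := ((auxL τ hτ).mul_ω₁_add_mul_ω₂_mem_lattice (α := a) (β := b)).not.2 h
  simpa [auxL] using this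

lemma aux_per (τ : ℂ) (hτ : 0 < τ.im) (z : ℂ) (a b : ℤ) :
    (auxL τ hτ).weierstrassP (z + (a + b * τ)) = (auxL τ hτ).weierstrassP z :=
  (auxL τ hτ).weierstrassP_add_coe z ⟨_, aux_mem τ hτ a b⟩

lemma aux_wpa (τ : ℂ) (hτ : 0 < τ.im) (z : ℂ) :
    wpa z τ = (Real.pi : ℂ)⁻¹ ^ 2 * (auxL τ hτ).weierstrassP z := by
  rw [wpa, ← (aux_hasSum_wp τ hτ z).tsum_eq, (aux_hasSum_wp τ hτ z).summable.tsum_eq_add_tsum_ite 0]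
  simp

lemma aux_wpt (τ : ℂ) (hτ : 0 < τ.im) (z : ℂ) :
    wpt z τ = (Real.pi : ℂ)⁻¹ ^ 2 * ((auxL τ hτ).weierstrassP (z + (1 + τ) / 2)
      - (auxL τ hτ).weierstrassP ((1 + τ) / 2)) := by
  rw [wpt]
  congr 1
  have h := (aux_hasSum_wp τ hτ (z + (1 + τ) / 2)).sub (aux_hasSum_wp τ hτ ((1 + τ) / 2))
  rw [← (Equiv.neg (ℤ × ℤ)).hasSum_iff] at h
  rw [← h.tsum_eq]
  refine tsum_congr fun p => ?_
  simp only [Function.comp, Equiv.neg_apply, Prod.fst_neg, Prod.snd_neg, Int.cast_neg]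
  rw [sub_sub_sub_cancel_right]
  congr 3 <;> ring

lemma aux_wpt' (τ : ℂ) (hτ : 0 < τ.im) (z : ℂ) :
    wpt z (τ + 1) = (Real.pi : ℂ)⁻¹ ^ 2 * ((auxL τ hτ).weierstrassP (z + τ / 2)
      - (auxL τ hτ).weierstrassP (τ / 2)) := by
  rw [wpt]
  congr 1
  have h := (aux_hasSum_wp τ hτ (z + τ / 2)).sub (aux_hasSum_wp τ hτ (τ / 2))
  let e : ℤ × ℤ ≃ ℤ × ℤ :=
    { toFun := fun p => (-(p.1 + p.2 + 1), -p.2)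
      invFun := fun p => (-p.1 + p.2 - 1, -p.2)
      left_inv := fun p => by ext <;> simp <;> ring
      right_inv := fun p => by ext <;> simp <;> ring }
  rw [← e.hasSum_iff] at h
  rw [← h.tsum_eq]
  refine tsum_congr fun p => ?_
  simp only [Function.comp, e, Equiv.coe_fn_mk, Int.cast_neg, Int.cast_add, Int.cast_one]
  rw [sub_sub_sub_cancel_right]
  congr 3 <;> ring

lemma aux_hasSum_wp_add (τ : ℂ) (hτ : 0 < τ.im) (z : ℂ) :
    HasSum (fun p : ℤ × ℤ => 1 / (z + ((p.2 : ℂ) + (p.1 : ℂ) * τ)) ^ 2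
      - 1 / ((p.2 : ℂ) + (p.1 : ℂ) * τ) ^ 2) ((auxL τ hτ).weierstrassP z) := by
  have h := aux_hasSum_wp τ hτ z
  rw [← ((Equiv.prodComm ℤ ℤ).trans (Equiv.neg (ℤ × ℤ))).hasSum_iff] at h
  convert h using 2 with p
  simp only [Function.comp, Equiv.trans_apply, Equiv.prodComm_apply, Equiv.neg_apply,
    Prod.fst_neg, Prod.snd_neg, Prod.fst_swap, Prod.snd_swap, Int.cast_neg]
  congr 2 <;> ring

lemma aux_hasSum_inv_add (τ : ℂ) (hτ : 0 < τ.im) (z : ℂ) :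
    HasSum (fun p : ℤ × ℤ => ((z + ((p.1 : ℂ) + (p.2 : ℂ) * τ)) ^ 4)⁻¹)
      ((auxL τ hτ).sumInvPow z 4) := by
  have h := aux_hasSum_inv τ hτ z
  rw [← (Equiv.neg (ℤ × ℤ)).hasSum_iff] at h
  convert h using 2 with p
  simp only [Function.comp, Equiv.neg_apply, Prod.fst_neg, Prod.snd_neg, Int.cast_neg]
  congr 1; ring

lemma aux_parity {f : ℤ → ℂ} (hf : Summable f) :
    Summable (fun n => f (2 * n)) ∧ Summable (fun n => f (2 * n + 1)) ∧
      ∑' n, f n = ∑' n, f (2 * n) + ∑' n, f (2 * n + 1) := by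
  have h0 : Summable (fun n => f (2 * n)) :=
    hf.comp_injective (i := fun n : ℤ => 2 * n) (fun a b h => by simpa using h)
  have h1 : Summable (fun n => f (2 * n + 1)) :=
    hf.comp_injective (i := fun n : ℤ => 2 * n + 1) (fun a b h => by simpa using h)
  refine ⟨h0, h1, ?_⟩
  let e : Fin 2 × ℤ ≃ ℤ := (Equiv.prodComm _ _).trans (Int.divModEquiv 2).symm
  have hs : Summable (fun p => f (e p)) := e.summable_iff.2 hf
  rw [← e.tsum_eq, hs.tsum_prod, tsum_fintype, Fin.sum_univ_two]
  congr 1 <;> refine tsum_congr fun n => ?_ <;> simp [e, mul_comm]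

lemma aux_parity2 {f : ℤ × ℤ → ℂ} (hf : Summable f) :
      ∑' p, f p = ∑' p : ℤ × ℤ, f (2 * p.1, 2 * p.2) + ∑' p : ℤ × ℤ, f (2 * p.1, 2 * p.2 + 1) +
       (∑' p : ℤ × ℤ, f (2 * p.1 + 1, 2 * p.2) + ∑' p : ℤ × ℤ, f (2 * p.1 + 1, 2 * p.2 + 1)) := by
  let e0 : Fin 2 × ℤ ≃ ℤ := (Equiv.prodComm _ _).trans (Int.divModEquiv 2).symm
  let e : (Fin 2 × Fin 2) × (ℤ × ℤ) ≃ ℤ × ℤ :=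
    (Equiv.prodProdProdComm _ _ _ _).trans (e0.prodCongr e0)
  have hs : Summable (fun p => f (e p)) := e.summable_iff.2 hf
  rw [← e.tsum_eq, hs.tsum_prod, tsum_fintype, Fintype.sum_prod_type, Fin.sum_univ_two,
    Fin.sum_univ_two, Fin.sum_univ_two]
  congr 2 <;> refine tsum_congr fun n => ?_ <;> simp [e, e0, mul_comm]

lemma aux_G4 (τ : ℂ) (hτ : 0 < τ.im) :
    (auxL τ hτ).sumInvPow (1 / 2) 4 + (auxL τ hτ).sumInvPow (τ / 2) 4 +
      (auxL τ hτ).sumInvPow ((1 + τ) / 2) 4 = 15 * (auxL τ hτ).G 4 := by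
  have h0 := aux_hasSum_inv_add τ hτ 0
  have hp := aux_parity2 h0.summable
  rw [h0.tsum_eq] at hp
  rw [← (auxL τ hτ).sumInvPow_zero]
  have key : ∀ (z : ℂ) (f : ℤ × ℤ → ℂ),
      (∀ p : ℤ × ℤ, f p = 1 / 16 * ((z + ((p.1 : ℂ) + (p.2 : ℂ) * τ)) ^ 4)⁻¹) →
      ∑' p, f p = 1 / 16 * (auxL τ hτ).sumInvPow z 4 := by
    intro z f hf
    rw [← (aux_hasSum_inv_add τ hτ z).tsum_eq, ← tsum_mul_left]
    exact tsum_congr hf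
  have aux : ∀ x y : ℂ, x = 2 * y → (x ^ 4)⁻¹ = 1 / 16 * (y ^ 4)⁻¹ := by
    rintro x y rfl
    rw [mul_pow, mul_inv]; norm_num
  rw [key 0, key (τ / 2), key (1 / 2), key ((1 + τ) / 2)] at hp
  · linear_combination -16 * hp
  all_goals
    intro p
    apply aux
    push_cast
    ring

lemma aux_row_summable (τ : ℂ) (hτ : 0 < τ.im) (m : ℤ) :
    Summable (fun n : ℤ => 1 / ((n : ℂ) + m * τ) ^ 2) := by
  have := EisensteinSeries.e2Summand_summable m ⟨τ, hτ⟩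
  refine this.congr fun n => ?_
  simp [EisensteinSeries.eisSummand, add_comm, zpow_neg]

lemma aux_e2_summable (z : UpperHalfPlane) : Summable (fun m : ℤ => EisensteinSeries.e2Summand m z) := by
  have hpos : Summable (fun m : ℕ => EisensteinSeries.e2Summand (m : ℤ) z) := by
    rw [← summable_nat_add_iff 1]
    have h : Summable (fun m : ℕ => -4 * (Real.pi : ℂ) ^ 2 * ∑' c : ℕ+, (c : ℂ) *
        Complex.exp (2 * Real.pi * Complex.I * z) ^ ((m + 1) * c : ℕ)) := by
      refine Summable.mul_left _ ?_
      rw [← summable_pnat_iff_summable_succ (f := fun b ↦ ∑' c : ℕ+, (c : ℂ) *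
        Complex.exp (2 * Real.pi * Complex.I * z) ^ (b * c : ℕ))]
      apply (summable_prod_mul_pow 1 (UpperHalfPlane.norm_exp_two_pi_I_lt_one z)).prod.congr
      simp [← Complex.exp_nsmul]
    refine h.congr fun m => ?_
    have H2 := EisensteinSeries.qExpansion_identity_pnat (k := 1) (by norm_num)
      ⟨(m + 1) * z, by simpa [show 0 < ((m + 1) : ℝ) by positivity] using z.2⟩
    simp only [EisensteinSeries.e2Summand, EisensteinSeries.eisSummand]
    trans ∑' n : ℤ, 1 / ((m + 1) * (z : ℂ) + n) ^ (1 + 1)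
    · refine Eq.trans ?_ H2.symm
      rw [show (-2 * (Real.pi : ℂ) * Complex.I) ^ (1 + 1) / (Nat.factorial 1 : ℕ) =
        -4 * (Real.pi : ℂ) ^ 2 by
          simp; linear_combination (4 * (Real.pi : ℂ) ^ 2) * Complex.I_sq]
      congr 1
      refine tsum_congr fun c => ?_
      rw [pow_one, ← Complex.exp_nat_mul, ← Complex.exp_nat_mul]
      push_cast
      congr 2
      ring
    · refine tsum_congr fun n => ?_
      simp
  refine Summable.of_nat_of_neg hpos ?_
  refine hpos.congr fun m => ?_
  exact (EisensteinSeries.e2Summand_even z _).symm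

lemma aux_rows (τ : ℂ) (hτ : 0 < τ.im) :
    Summable (fun m : ℤ => ∑' n : ℤ, 1 / ((n : ℂ) + m * τ) ^ 2) := by
  refine (aux_e2_summable ⟨τ, hτ⟩).congr fun m => ?_
  refine tsum_congr fun n => ?_
  simp [EisensteinSeries.eisSummand, add_comm, zpow_neg]

lemma aux_sum_e (τ : ℂ) (hτ : 0 < τ.im) :
    (auxL τ hτ).weierstrassP (1 / 2) + (auxL τ hτ).weierstrassP (τ / 2) +
      (auxL τ hτ).weierstrassP ((1 + τ) / 2) = 0 := by
  have H := ((aux_hasSum_wp_add τ hτ (1 / 2)).add (aux_hasSum_wp_add τ hτ (τ / 2))).add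
    (aux_hasSum_wp_add τ hτ ((1 + τ) / 2))
  set R : ℤ → ℂ := fun m : ℤ => ∑' n : ℤ, 1 / ((n : ℂ) + m * τ) ^ 2 with hR
  have aux : ∀ x y : ℂ, x = 2 * y → 1 / y ^ 2 = 4 * (1 / x ^ 2) := by
    rintro x y rfl
    rw [mul_pow, one_div, one_div, mul_inv]; ring
  have hfib : ∀ m : ℤ, HasSum (fun n : ℤ =>
      (1 / (1 / 2 + ((n : ℂ) + (m : ℂ) * τ)) ^ 2 - 1 / ((n : ℂ) + (m : ℂ) * τ) ^ 2) +
      (1 / (τ / 2 + ((n : ℂ) + (m : ℂ) * τ)) ^ 2 - 1 / ((n : ℂ) + (m : ℂ) * τ) ^ 2) +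
      (1 / ((1 + τ) / 2 + ((n : ℂ) + (m : ℂ) * τ)) ^ 2 - 1 / ((n : ℂ) + (m : ℂ) * τ) ^ 2))
      (4 * R (2 * m) + 4 * R (2 * m + 1) - 4 * R m) := by
    intro m
    obtain ⟨a0, a1, a2⟩ := aux_parity (aux_row_summable τ hτ (2 * m))
    obtain ⟨b0, b1, b2⟩ := aux_parity (aux_row_summable τ hτ (2 * m + 1))
    have c := (aux_row_summable τ hτ m).hasSum
    have d := (((((a0.hasSum.add a1.hasSum).add (b0.hasSum.add b1.hasSum)).mul_left 4).sub
      (c.mul_left 4)))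
    rw [← a2, ← b2] at d
    rw [show 4 * R (2 * m) + 4 * R (2 * m + 1) - 4 * R m =
      4 * (R (2 * m) + R (2 * m + 1)) - 4 * R m by ring]
    refine Eq.mp (congrArg (fun F => HasSum F _) (funext fun n => Eq.symm ?_)) d
    have e0 := aux (((2 * n : ℤ) : ℂ) + ((2 * m : ℤ) : ℂ) * τ) ((n : ℂ) + (m : ℂ) * τ)
      (by push_cast; ring)
    have e1 := aux (((2 * n + 1 : ℤ) : ℂ) + ((2 * m : ℤ) : ℂ) * τ)
      (1 / 2 + ((n : ℂ) + (m : ℂ) * τ)) (by push_cast; ring)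
    have e2 := aux (((2 * n : ℤ) : ℂ) + ((2 * m + 1 : ℤ) : ℂ) * τ)
      (τ / 2 + ((n : ℂ) + (m : ℂ) * τ)) (by push_cast; ring)
    have e3 := aux (((2 * n + 1 : ℤ) : ℂ) + ((2 * m + 1 : ℤ) : ℂ) * τ)
      ((1 + τ) / 2 + ((n : ℂ) + (m : ℂ) * τ)) (by push_cast; ring)
    linear_combination e0 + e1 + e2 + e3
  have H2 := H.prod_fiberwise hfib
  obtain ⟨r0, r1, r2⟩ := aux_parity (aux_rows τ hτ)
  have H3 := ((r0.hasSum.mul_left 4).add (r1.hasSum.mul_left 4)).sub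
    ((aux_rows τ hτ).hasSum.mul_left 4)
  rw [H2.unique H3, r2]
  ring

lemma aux_E4 (τ : ℂ) (hτ : 0 < τ.im) :
    1 + 240 * ∑' n : ℕ, (ArithmeticFunction.sigma 3 (n + 1) : ℂ) *
          Complex.exp (2 * Real.pi * Complex.I * τ) ^ (n + 1) =
      45 * (Real.pi : ℂ)⁻¹ ^ 4 * (auxL τ hτ).G 4 := by
  have h := tsum_eisSummand_eq_tsum_sigma_mul_cexp_pow (k := 4) (by norm_num) (by decide) ⟨τ, hτ⟩
  rw [tsum_pnat_eq_tsum_succ (f := fun n : ℕ => (ArithmeticFunction.sigma (4 - 1) n : ℂ) *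
    Complex.exp (2 * Real.pi * Complex.I * τ) ^ n)] at h
  have hG : (auxL τ hτ).G 4 =
      ∑' v : Fin 2 → ℤ, EisensteinSeries.eisSummand (4 : ℕ) v ⟨τ, hτ⟩ := by
    rw [← (auxL τ hτ).sumInvPow_zero, ← (aux_hasSum_inv_add τ hτ 0).tsum_eq,
      ← ((Equiv.prodComm ℤ ℤ).trans (finTwoArrowEquiv ℤ).symm).tsum_eq]
    refine tsum_congr fun p => ?_
    simp [EisensteinSeries.eisSummand, add_comm, zpow_neg]
  rw [hG, h]
  have hz : riemannZeta (4 : ℕ) = (Real.pi : ℂ) ^ 4 / 90 := by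
    simpa using riemannZeta_four
  rw [hz]
  have hpi : (Real.pi : ℂ) ≠ 0 := by exact_mod_cast Real.pi_ne_zero
  have hI : (-2 * (Real.pi : ℂ) * Complex.I) ^ 4 = 16 * (Real.pi : ℂ) ^ 4 := by
    rw [mul_pow, Complex.I_pow_four]; ring
  rw [hI]
  norm_num [Nat.factorial]
  field_simp
  ring

/-- With `q = e^{2πiτ}`, the weight-4 Eisenstein series `E₄(τ) = 1 + 240 Σ_{n≥1} σ₃(n) qⁿ`
satisfies `E₄ = (1/2)(℘̃a(1/2,τ)² + ℘̃a(τ/2,τ)² + ℘̃a((τ+1)/2,τ+1)²)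
= 3(℘a(1/2,τ)² + ℘a(τ/2,τ)² + ℘a(1/2,τ)℘a(τ/2,τ))`. -/
theorem eisenstein_four_wpt_wpa (τ : ℂ) (hτ : 0 < τ.im) :
    (1 + 240 * ∑' n : ℕ,
        (ArithmeticFunction.sigma 3 (n + 1) : ℂ) *
          Complex.exp (2 * Real.pi * Complex.I * τ) ^ (n + 1) =
      1 / 2 * (wpt (1 / 2) τ ^ 2 + wpt (τ / 2) τ ^ 2 + wpt ((τ + 1) / 2) (τ + 1) ^ 2)) ∧
    1 + 240 * ∑' n : ℕ,
        (ArithmeticFunction.sigma 3 (n + 1) : ℂ) *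
          Complex.exp (2 * Real.pi * Complex.I * τ) ^ (n + 1) =
      3 * (wpa (1 / 2) τ ^ 2 + wpa (τ / 2) τ ^ 2 + wpa (1 / 2) τ * wpa (τ / 2) τ) := by
  set L := auxL τ hτ with hL
  have n1 : (1 / 2 : ℂ) ∉ L.lattice := by
    have := aux_notMem τ hτ (1 / 2) 0 (by norm_num)
    simpa using this
  have n2 : (τ / 2 : ℂ) ∉ L.lattice := by
    have := aux_notMem τ hτ 0 (1 / 2) (by norm_num)
    have e : (τ / 2 : ℂ) = ((0 : ℚ) : ℂ) + ((1 / 2 : ℚ) : ℂ) * τ := by push_cast; ring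
    rw [e]; exact this
  have n3 : ((1 + τ) / 2 : ℂ) ∉ L.lattice := by
    have := aux_notMem τ hτ (1 / 2) (1 / 2) (by norm_num)
    have e : ((1 + τ) / 2 : ℂ) = ((1 / 2 : ℚ) : ℂ) + ((1 / 2 : ℚ) : ℂ) * τ := by push_cast; ring
    rw [e]; exact this
  have s1 := aux_wp_second L _ n1
  have s2 := aux_wp_second L _ n2
  have s3 := aux_wp_second L _ n3
  have sG := aux_G4 τ hτ
  have sE := aux_sum_e τ hτ
  rw [aux_E4 τ hτ, aux_wpa τ hτ, aux_wpa τ hτ, aux_wpt τ hτ, aux_wpt τ hτ, aux_wpt' τ hτ]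
  have t1 : L.weierstrassP (1 / 2 + (1 + τ) / 2) = L.weierstrassP (τ / 2) := by
    rw [← aux_per τ hτ (τ / 2) 1 0]; congr 1; push_cast; ring
  have t2 : L.weierstrassP (τ / 2 + (1 + τ) / 2) = L.weierstrassP (1 / 2) := by
    rw [← aux_per τ hτ (1 / 2) 0 1]; congr 1; push_cast; ring
  have t3 : L.weierstrassP ((τ + 1) / 2 + τ / 2) = L.weierstrassP (1 / 2) := by
    rw [← aux_per τ hτ (1 / 2) 0 1]; congr 1; push_cast; ring
  rw [PeriodPair.g₂] at s1 s2 s3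
  rw [← hL] at sG sE ⊢
  rw [t1, t2, t3]
  generalize L.weierstrassP (1 / 2) = e1 at *
  generalize L.weierstrassP (τ / 2) = e2 at *
  generalize L.weierstrassP ((1 + τ) / 2) = e3 at *
  generalize L.G 4 = G at *
  have hs : e1 ^ 2 + e2 ^ 2 + e3 ^ 2 = 30 * G := by
    linear_combination -(s1 + s2 + s3) / 6 + sG
  have h3 : e3 = -e1 - e2 := by linear_combination sE
  subst h3
  have hq : e1 ^ 2 + e2 ^ 2 + e1 * e2 = 15 * G := by linear_combination hs / 2
  constructor
  · linear_combination (-3 * (Real.pi : ℂ)⁻¹ ^ 4) * hq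
  · linear_combination (-3 * (Real.pi : ℂ)⁻¹ ^ 4) * hq
end
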